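/- Completeness: For any set Γ ∪ {φ} of L-sentences, if Γ ⊨ φ then Γ ⊢ φ. -/

import Mathlib

universe u v

namespace BQL

structure Signature : Type 1 where
  Const : Type
  Func : Type
  arityF : Func → ℕ
  Rel : Type
  arityR : Rel → ℕ

inductive Term (L : Signature) : Type
  | var : ℕ → Term L
  | const : L.Const → Term L
  | func : (f : L.Func) → (Fin (L.arityF f) → Term L) → Term L

inductive Formula (L : Signature) : Type
  | top : Formula L
  | bot : Formula L
  | rel : (R : L.Rel) → (Fin (L.arityR R) → Term L) → Formula L
  | and : Formula L → Formula L → Formula L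
  | or : Formula L → Formula L → Formula L
  | imp : Formula L → Formula L → Formula L
  | all : Formula L → Formula L
  | ex : Formula L → Formula L

variable {L : Signature}

namespace Term

/-- Shift all (free) variables of a term up by one. -/
def shiftUp : Term L → Term L
  | var n => var (n + 1)
  | const c => const c
  | func f ts => func f fun i => (ts i).shiftUp

/-- Apply a simultaneous substitution to a term. -/
def applySub (σ : ℕ → Term L) : Term L → Term L
  | var n => σ n
  | const c => const c
  | func f ts => func f fun i => (ts i).applySub σ

/-- All variables of the term are `< k`. -/
def ClosedAt : Term L → ℕ → Prop
  | var n, k => n < k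
  | const _, _ => True
  | func _ ts, k => ∀ i, (ts i).ClosedAt k

/-- A closed term. -/
def Closed (t : Term L) : Prop := t.ClosedAt 0

/-- The constant `c` occurs in the term. -/
def OccC (c : L.Const) : Term L → Prop
  | var _ => False
  | const d => d = c
  | func _ ts => ∃ i, (ts i).OccC c

end Term

/-- Lift a substitution under a binder. -/
def liftSub (σ : ℕ → Term L) : ℕ → Term L
  | 0 => .var 0
  | n + 1 => (σ n).shiftUp

namespace Formula

/-- Apply a simultaneous substitution to a formula. -/
def applySub (σ : ℕ → Term L) : Formula L → Formula L
  | top => top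
  | bot => bot
  | rel R ts => rel R fun i => (ts i).applySub σ
  | and φ ψ => and (φ.applySub σ) (ψ.applySub σ)
  | or φ ψ => or (φ.applySub σ) (ψ.applySub σ)
  | imp φ ψ => imp (φ.applySub σ) (ψ.applySub σ)
  | all φ => all (φ.applySub (liftSub σ))
  | ex φ => ex (φ.applySub (liftSub σ))

/-- All free variables of the formula are `< k`. -/
def ClosedAt : Formula L → ℕ → Prop
  | top, _ => True
  | bot, _ => True
  | rel _ ts, k => ∀ i, (ts i).ClosedAt k
  | and φ ψ, k => φ.ClosedAt k ∧ ψ.ClosedAt k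
  | or φ ψ, k => φ.ClosedAt k ∧ ψ.ClosedAt k
  | imp φ ψ, k => φ.ClosedAt k ∧ ψ.ClosedAt k
  | all φ, k => φ.ClosedAt (k + 1)
  | ex φ, k => φ.ClosedAt (k + 1)

/-- A sentence: a formula with no free variables. -/
def Sentence (φ : Formula L) : Prop := φ.ClosedAt 0

/-- The constant `c` occurs in the formula. -/
def OccC (c : L.Const) : Formula L → Prop
  | top => False
  | bot => False
  | rel _ ts => ∃ i, (ts i).OccC c
  | and φ ψ => φ.OccC c ∨ ψ.OccC c
  | or φ ψ => φ.OccC c ∨ ψ.OccC c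
  | imp φ ψ => φ.OccC c ∨ ψ.OccC c
  | all φ => φ.OccC c
  | ex φ => φ.OccC c

/-- The formula contains no occurrence of `∨` and no occurrence of `∃`. -/
def NoOrEx : Formula L → Prop
  | top => True
  | bot => True
  | rel _ _ => True
  | and φ ψ => φ.NoOrEx ∧ ψ.NoOrEx
  | or _ _ => False
  | imp φ ψ => φ.NoOrEx ∧ ψ.NoOrEx
  | all φ => φ.NoOrEx
  | ex _ => False

end Formula

/-- Substitute the term `t` for the variable `v₀` (lowering the other variables). -/
def subst0 (φ : Formula L) (t : Term L) : Formula L :=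
  φ.applySub fun n => match n with | 0 => t | n + 1 => .var n

/-- `□ⁿφ`, where `□φ` abbreviates `⊤ → φ`. -/
def boxN : ℕ → Formula L → Formula L
  | 0, φ => φ
  | n + 1, φ => .imp .top (boxN n φ)

/-- The conjunction of a finite list of formulas (`⋀∅ = ⊤`). -/
def conjL : List (Formula L) → Formula L
  | [] => .top
  | [φ] => φ
  | φ :: ψ :: l => .and φ (conjL (ψ :: l))

/-- The language `L⁺`, obtained from `L` by adding countably many fresh constants `aᵢ`. -/
def Signature.plus (L : Signature) : Signature where
  Const := L.Const ⊕ ℕ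
  Func := L.Func
  arityF := L.arityF
  Rel := L.Rel
  arityR := L.arityR

/-- The fresh constant `aᵢ` of `L⁺`. -/
def aconst (L : Signature) (i : ℕ) : Term L.plus := .const (Sum.inr i)

/-- Embedding of `L`-terms into `L⁺`-terms. -/
def Term.emb : Term L → Term L.plus
  | .var n => .var n
  | .const c => .const (Sum.inl c)
  | .func f ts => .func f fun i => (ts i).emb

/-- Embedding of `L`-formulas into `L⁺`-formulas. -/
def Formula.emb : Formula L → Formula L.plus
  | .top => .top
  | .bot => .bot
  | .rel R ts => .rel R fun i => (ts i).emb
  | .and φ ψ => .and φ.emb ψ.emb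
  | .or φ ψ => .or φ.emb ψ.emb
  | .imp φ ψ => .imp φ.emb ψ.emb
  | .all φ => .all φ.emb
  | .ex φ => .ex φ.emb

/-- The fresh constant `aᵢ` occurs in no member of `Γ`. -/
def FreshIn (i : ℕ) (Γ : Set (Formula L.plus)) : Prop :=
  ∀ ψ ∈ Γ, ¬ ψ.OccC (Sum.inr i)

/-- A Kripke `L`-model (the frame conditions are packaged in `KModel.Proper`). -/
structure KModel (L : Signature) : Type (u + 1) where
  W : Type u
  acc : W → W → Prop
  D : Type u
  interpC : L.Const → D
  interpF : (f : L.Func) → (Fin (L.arityF f) → D) → D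
  interpR : (R : L.Rel) → W → Set (Fin (L.arityR R) → D)

/-- The conditions on an `L`-model: nonempty set of worlds, transitive accessibility
relation, nonempty domain, and the persistence constraint. -/
def KModel.Proper (M : KModel.{u} L) : Prop :=
  Nonempty M.W ∧ Nonempty M.D ∧ Transitive M.acc ∧
    ∀ (R : L.Rel) (w u' : M.W), M.acc w u' → M.interpR R w ⊆ M.interpR R u'

/-- Prepend a value to a valuation. -/
def vcons {α : Sort*} (d : α) (ρ : ℕ → α) : ℕ → α
  | 0 => d
  | n + 1 => ρ n

/-- Denotation of a term. -/
def Term.eval (M : KModel.{u} L) (ρ : ℕ → M.D) : Term L → M.D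
  | .var n => ρ n
  | .const c => M.interpC c
  | .func f ts => M.interpF f fun i => (ts i).eval M ρ

/-- The satisfaction relation `w ⊩ φ(ā)`. -/
def Sat (M : KModel.{u} L) : M.W → (ℕ → M.D) → Formula L → Prop
  | _, _, .top => True
  | _, _, .bot => False
  | w, ρ, .rel R ts => (fun i => (ts i).eval M ρ) ∈ M.interpR R w
  | w, ρ, .and φ ψ => Sat M w ρ φ ∧ Sat M w ρ ψ
  | w, ρ, .or φ ψ => Sat M w ρ φ ∨ Sat M w ρ ψ
  | w, ρ, .imp φ ψ => ∀ u', M.acc w u' → Sat M u' ρ φ → Sat M u' ρ ψ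
  | w, ρ, .all φ => ∀ d, Sat M w (vcons d ρ) φ
  | w, ρ, .ex φ => ∃ d, Sat M w (vcons d ρ) φ

/-- Satisfaction of a sentence (under every valuation). -/
def SatS (M : KModel.{u} L) (w : M.W) (φ : Formula L) : Prop := ∀ ρ, Sat M w ρ φ

/-- `Γ ⊨ φ`: truth is preserved at every reflexive world of every `L`-model. -/
def Models (Γ : Set (Formula L)) (φ : Formula L) : Prop :=
  ∀ M : KModel.{u} L, M.Proper → ∀ w : M.W, M.acc w w →
    (∀ ψ ∈ Γ, SatS M w ψ) → SatS M w φ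

/-- `Γ : Δ ⊨ φ`: for every `L`-model, every reflexive world `w` and every world `u ≻ w`:
if `w ⊩ Γ` and `u ⊩ Δ` then `u ⊩ φ`. -/
def ModelsCtx (Γ Δ : Set (Formula L)) (φ : Formula L) : Prop :=
  ∀ M : KModel.{u} L, M.Proper → ∀ w u' : M.W, M.acc w w → M.acc w u' →
    (∀ ψ ∈ Γ, SatS M w ψ) → (∀ ψ ∈ Δ, SatS M u' ψ) → SatS M u' φ

end BQL

namespace BQL

/-- `Prf L Γ Δ φ` formalizes `Γ : Δ ⊢ φ`: there is a proof of `φ` in the natural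
deduction system `NBQL_CD^r` (over `L⁺`-sentences) whose open assumptions all belong
to `Γ ∪ Δ` and in which every open assumption occurring *unsafely* (i.e. in the right
main subproof of an application of `→`-Elim) belongs to `Γ`.  Assumptions may be
discharged only at safe occurrences, so discharge always happens in the `Δ` zone. -/
inductive Prf (L : Signature) :
    Set (Formula L.plus) → Set (Formula L.plus) → Formula L.plus → Prop
  | hyp {Γ Δ : Set (Formula L.plus)} {φ} : φ ∈ Γ ∪ Δ → φ.Sentence → Prf L Γ Δ φ
  | weaken {Γ Γ' Δ Δ' φ} : Γ ⊆ Γ' → Δ ⊆ Δ' → Prf L Γ Δ φ → Prf L Γ' Δ' φ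
  | topIntro {Γ Δ} : Prf L Γ Δ .top
  | botElim {Γ Δ φ} : φ.Sentence → Prf L Γ Δ .bot → Prf L Γ Δ φ
  | andIntro {Γ Δ φ ψ} : Prf L Γ Δ φ → Prf L Γ Δ ψ → Prf L Γ Δ (.and φ ψ)
  | andElimL {Γ Δ φ ψ} : Prf L Γ Δ (.and φ ψ) → Prf L Γ Δ φ
  | andElimR {Γ Δ φ ψ} : Prf L Γ Δ (.and φ ψ) → Prf L Γ Δ ψ
  | orIntroL {Γ Δ φ ψ} : ψ.Sentence → Prf L Γ Δ φ → Prf L Γ Δ (.or φ ψ)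
  | orIntroR {Γ Δ φ ψ} : φ.Sentence → Prf L Γ Δ ψ → Prf L Γ Δ (.or φ ψ)
  | orElim {Γ Δ φ ψ χ} : Prf L Γ Δ (.or φ ψ) → Prf L Γ (insert φ Δ) χ →
      Prf L Γ (insert ψ Δ) χ → Prf L Γ Δ χ
  | impIntro {Γ Δ φ ψ} : φ.Sentence → Prf L Γ (insert φ Δ) ψ → Prf L Γ Δ (.imp φ ψ)
  | impElim {Γ Δ φ ψ} : Prf L Γ Δ φ → Prf L Γ ∅ (.imp φ ψ) → Prf L Γ Δ ψ
  | intTrans {Γ Δ φ ψ χ} : Prf L Γ Δ (.imp φ ψ) → Prf L Γ Δ (.imp ψ χ) →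
      Prf L Γ Δ (.imp φ χ)
  | intAndIntro {Γ Δ φ ψ χ} : Prf L Γ Δ (.imp φ ψ) → Prf L Γ Δ (.imp φ χ) →
      Prf L Γ Δ (.imp φ (.and ψ χ))
  | intOrElim {Γ Δ φ ψ χ} : Prf L Γ Δ (.imp φ χ) → Prf L Γ Δ (.imp ψ χ) →
      Prf L Γ Δ (.imp (.or φ ψ) χ)
  | intAllIntro {Γ Δ φ ψ} : φ.Sentence → Prf L Γ Δ (.all (.imp φ ψ)) →
      Prf L Γ Δ (.imp φ (.all ψ))
  | intExElim {Γ Δ φ ψ} : ψ.Sentence → Prf L Γ Δ (.all (.imp φ ψ)) →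
      Prf L Γ Δ (.imp (.ex φ) ψ)
  | allIntro {Γ Δ Γ' Δ' φ} {i : ℕ} : Γ' ⊆ Γ → Δ' ⊆ Δ → FreshIn i Γ' → FreshIn i Δ' →
      ¬ φ.OccC (Sum.inr i) → Prf L Γ' Δ' (subst0 φ (aconst L i)) → Prf L Γ Δ (.all φ)
  | allElim {Γ Δ φ} {t : Term L.plus} : t.Closed → Prf L Γ Δ (.all φ) →
      Prf L Γ Δ (subst0 φ t)
  | cd {Γ Δ φ ψ} : φ.Sentence → Prf L Γ Δ (.all (.or φ ψ)) → Prf L Γ Δ (.or φ (.all ψ))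
  | exIntro {Γ Δ φ} {t : Term L.plus} : t.Closed → (Formula.ex φ).Sentence →
      Prf L Γ Δ (subst0 φ t) → Prf L Γ Δ (.ex φ)
  | exElim {Γ Δ Γ' Δ' φ ψ} {i : ℕ} : Γ' ⊆ Γ → Δ' ⊆ Δ → FreshIn i Γ' → FreshIn i Δ' →
      ¬ φ.OccC (Sum.inr i) → ¬ ψ.OccC (Sum.inr i) → Prf L Γ Δ (.ex φ) →
      Prf L Γ' (insert (subst0 φ (aconst L i)) Δ') ψ → Prf L Γ Δ ψ

/-- `Γ ⊢ φ`: there is a proof of `φ` from `Γ` in `NBQL_CD^r`. -/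
def Prv (L : Signature) (Γ : Set (Formula L.plus)) (φ : Formula L.plus) : Prop :=
  Prf L Γ ∅ φ

end BQL

namespace BQL

variable {L : Signature}

namespace Term

theorem applySub_shiftUp_left (τ : ℕ → Term L) (t : Term L) :
    t.shiftUp.applySub τ = t.applySub fun n => τ (n + 1) := by
  induction t with
  | var n => rfl
  | const c => rfl
  | func f ts ih => simp only [shiftUp, applySub, ih]

theorem shiftUp_applySub (σ : ℕ → Term L) (t : Term L) :
    (t.applySub σ).shiftUp = t.applySub fun n => (σ n).shiftUp := by
  induction t with
  | var n => rfl
  | const c => rfl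
  | func f ts ih => simp only [shiftUp, applySub, ih]

theorem applySub_applySub (σ τ : ℕ → Term L) (t : Term L) :
    (t.applySub σ).applySub τ = t.applySub fun n => (σ n).applySub τ := by
  induction t with
  | var n => rfl
  | const c => rfl
  | func f ts ih => simp only [applySub, ih]

theorem applySub_var (t : Term L) : t.applySub var = t := by
  induction t with
  | var n => rfl
  | const c => rfl
  | func f ts ih => simp only [applySub, ih]

theorem applySub_congr {σ τ : ℕ → Term L} {k : ℕ} {t : Term L} (ht : t.ClosedAt k)
    (h : ∀ n < k, σ n = τ n) : t.applySub σ = t.applySub τ := by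
  induction t with
  | var n => exact h n ht
  | const c => rfl
  | func f ts ih => simp only [applySub, fun i => ih i (ht i)]

theorem closedAt_shiftUp {t : Term L} {k : ℕ} :
    t.shiftUp.ClosedAt (k + 1) ↔ t.ClosedAt k := by
  induction t with
  | var n => simp [shiftUp, ClosedAt]
  | const c => simp [shiftUp, ClosedAt]
  | func f ts ih => simp only [shiftUp, ClosedAt, ih]

theorem ClosedAt.applySub {σ : ℕ → Term L} {k m : ℕ} {t : Term L} (ht : t.ClosedAt k)
    (h : ∀ n < k, (σ n).ClosedAt m) : (t.applySub σ).ClosedAt m := by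
  induction t with
  | var n => exact h n ht
  | const c => trivial
  | func f ts ih => exact fun i => ih i (ht i)

theorem applySub_closedAt {σ : ℕ → Term L} {m : ℕ} (h : ∀ n, (σ n).ClosedAt m) (t : Term L) :
    (t.applySub σ).ClosedAt m := by
  induction t with
  | var n => exact h n
  | const c => trivial
  | func f ts ih => exact fun i => ih i

theorem ClosedAt.of_applySub {σ : ℕ → Term L} {k m : ℕ} {t : Term L}
    (h : ∀ n, (σ n).ClosedAt m → n < k) (ht : (t.applySub σ).ClosedAt m) : t.ClosedAt k := by
  induction t with
  | var n => exact h n ht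
  | const c => trivial
  | func f ts ih => exact fun i => ih i (ht i)

end Term

theorem liftSub_var : liftSub (Term.var : ℕ → Term L) = Term.var := by
  funext n; cases n <;> rfl

theorem liftSub_applySub (σ τ : ℕ → Term L) :
    (fun n => (liftSub σ n).applySub (liftSub τ)) = liftSub fun n => (σ n).applySub τ := by
  funext n
  cases n with
  | zero => rfl
  | succ n =>
    simp only [liftSub, Term.applySub_shiftUp_left, Term.shiftUp_applySub]

theorem liftSub_closedAt {σ : ℕ → Term L} {k m : ℕ} (h : ∀ n < k, (σ n).ClosedAt m) :
    ∀ n < k + 1, (liftSub σ n).ClosedAt (m + 1) := by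
  intro n hn
  cases n with
  | zero => exact Nat.succ_pos m
  | succ n => exact Term.closedAt_shiftUp.2 (h n (by omega))

theorem lt_of_liftSub_closedAt {σ : ℕ → Term L} {k m : ℕ}
    (h : ∀ n, (σ n).ClosedAt m → n < k) :
    ∀ n, (liftSub σ n).ClosedAt (m + 1) → n < k + 1 := by
  intro n hn
  cases n with
  | zero => omega
  | succ n => exact Nat.succ_lt_succ (h n (Term.closedAt_shiftUp.1 hn))

namespace Formula

theorem applySub_applySub (σ τ : ℕ → Term L) (φ : Formula L) :
    (φ.applySub σ).applySub τ = φ.applySub fun n => (σ n).applySub τ := by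
  induction φ generalizing σ τ with
  | top => rfl
  | bot => rfl
  | rel R ts => simp only [applySub, Term.applySub_applySub]
  | and φ ψ ih₁ ih₂ => simp only [applySub, ih₁, ih₂]
  | or φ ψ ih₁ ih₂ => simp only [applySub, ih₁, ih₂]
  | imp φ ψ ih₁ ih₂ => simp only [applySub, ih₁, ih₂]
  | all φ ih => simp only [applySub, ih, liftSub_applySub]
  | ex φ ih => simp only [applySub, ih, liftSub_applySub]

theorem applySub_var (φ : Formula L) : φ.applySub Term.var = φ := by
  induction φ with
  | top => rfl
  | bot => rfl
  | rel R ts => simp only [applySub, Term.applySub_var]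
  | and φ ψ ih₁ ih₂ => simp only [applySub, ih₁, ih₂]
  | or φ ψ ih₁ ih₂ => simp only [applySub, ih₁, ih₂]
  | imp φ ψ ih₁ ih₂ => simp only [applySub, ih₁, ih₂]
  | all φ ih => simp only [applySub, liftSub_var, ih]
  | ex φ ih => simp only [applySub, liftSub_var, ih]

theorem applySub_congr {σ τ : ℕ → Term L} {k : ℕ} {φ : Formula L} (hφ : φ.ClosedAt k)
    (h : ∀ n < k, σ n = τ n) : φ.applySub σ = φ.applySub τ := by
  have lift : ∀ {σ τ : ℕ → Term L} {k : ℕ}, (∀ n < k, σ n = τ n) →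
      ∀ n < k + 1, liftSub σ n = liftSub τ n := by
    intro σ τ k h n hn
    cases n with
    | zero => rfl
    | succ n => simp only [liftSub, h n (by omega)]
  induction φ generalizing σ τ k with
  | top => rfl
  | bot => rfl
  | rel R ts => simp only [applySub, fun i => Term.applySub_congr (hφ i) h]
  | and φ ψ ih₁ ih₂ => simp only [applySub, ih₁ hφ.1 h, ih₂ hφ.2 h]
  | or φ ψ ih₁ ih₂ => simp only [applySub, ih₁ hφ.1 h, ih₂ hφ.2 h]
  | imp φ ψ ih₁ ih₂ => simp only [applySub, ih₁ hφ.1 h, ih₂ hφ.2 h]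
  | all φ ih => simp only [applySub, ih (k := k + 1) hφ (lift h)]
  | ex φ ih => simp only [applySub, ih (k := k + 1) hφ (lift h)]

theorem Sentence.applySub_eq {φ : Formula L} (hφ : φ.Sentence) (σ : ℕ → Term L) :
    φ.applySub σ = φ := by
  rw [applySub_congr hφ (τ := Term.var) (by simp), applySub_var]

theorem ClosedAt.applySub {σ : ℕ → Term L} {k m : ℕ} {φ : Formula L} (hφ : φ.ClosedAt k)
    (h : ∀ n < k, (σ n).ClosedAt m) : (φ.applySub σ).ClosedAt m := by
  induction φ generalizing σ k m with
  | top => trivial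
  | bot => trivial
  | rel R ts => exact fun i => (hφ i).applySub h
  | and φ ψ ih₁ ih₂ => exact ⟨ih₁ hφ.1 h, ih₂ hφ.2 h⟩
  | or φ ψ ih₁ ih₂ => exact ⟨ih₁ hφ.1 h, ih₂ hφ.2 h⟩
  | imp φ ψ ih₁ ih₂ => exact ⟨ih₁ hφ.1 h, ih₂ hφ.2 h⟩
  | all φ ih => exact ih (k := k + 1) hφ (liftSub_closedAt h)
  | ex φ ih => exact ih (k := k + 1) hφ (liftSub_closedAt h)

theorem applySub_closedAt {σ : ℕ → Term L} {m : ℕ} (h : ∀ n, (σ n).ClosedAt m)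
    (φ : Formula L) : (φ.applySub σ).ClosedAt m := by
  have lift : ∀ {σ : ℕ → Term L} {m : ℕ}, (∀ n, (σ n).ClosedAt m) →
      ∀ n, (liftSub σ n).ClosedAt (m + 1) :=
    fun h n => liftSub_closedAt (k := n) (fun n _ => h n) n n.lt_succ_self
  induction φ generalizing σ m with
  | top => trivial
  | bot => trivial
  | rel R ts => exact fun i => Term.applySub_closedAt h (ts i)
  | and φ ψ ih₁ ih₂ => exact ⟨ih₁ h, ih₂ h⟩
  | or φ ψ ih₁ ih₂ => exact ⟨ih₁ h, ih₂ h⟩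
  | imp φ ψ ih₁ ih₂ => exact ⟨ih₁ h, ih₂ h⟩
  | all φ ih => exact ih (lift h)
  | ex φ ih => exact ih (lift h)

theorem ClosedAt.of_applySub {σ : ℕ → Term L} {k m : ℕ} {φ : Formula L}
    (h : ∀ n, (σ n).ClosedAt m → n < k) (hφ : (φ.applySub σ).ClosedAt m) :
    φ.ClosedAt k := by
  induction φ generalizing σ k m with
  | top => trivial
  | bot => trivial
  | rel R ts => exact fun i => (hφ i).of_applySub h
  | and φ ψ ih₁ ih₂ => exact ⟨ih₁ h hφ.1, ih₂ h hφ.2⟩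
  | or φ ψ ih₁ ih₂ => exact ⟨ih₁ h hφ.1, ih₂ h hφ.2⟩
  | imp φ ψ ih₁ ih₂ => exact ⟨ih₁ h hφ.1, ih₂ h hφ.2⟩
  | all φ ih => exact ih (k := k + 1) (lt_of_liftSub_closedAt h) hφ
  | ex φ ih => exact ih (k := k + 1) (lt_of_liftSub_closedAt h) hφ

end Formula

theorem subst0_eq_applySub (φ : Formula L) (t : Term L) :
    subst0 φ t = φ.applySub (vcons t Term.var) := by
  unfold subst0
  congr 1

theorem subst0_liftSub (φ : Formula L) (ρ : ℕ → Term L) (t : Term L) :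
    subst0 (φ.applySub (liftSub ρ)) t = φ.applySub (vcons t ρ) := by
  rw [subst0_eq_applySub, Formula.applySub_applySub]
  congr 1
  funext n
  cases n with
  | zero => rfl
  | succ n =>
    simp only [liftSub, Term.applySub_shiftUp_left, vcons]
    exact Term.applySub_var _

theorem Formula.Sentence.subst0_eq {φ : Formula L} (hφ : φ.Sentence) (t : Term L) :
    subst0 φ t = φ := hφ.applySub_eq _

theorem sentence_subst0 {φ : Formula L} {t : Term L} (hφ : φ.ClosedAt 1) (ht : t.Closed) :
    (subst0 φ t).Sentence := by
  rw [subst0_eq_applySub]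
  refine hφ.applySub fun n hn => ?_
  obtain rfl : n = 0 := by omega
  exact ht

theorem closedAt_one_of_subst0 {φ : Formula L} {t : Term L} (h : (subst0 φ t).Sentence) :
    φ.ClosedAt 1 := by
  rw [subst0_eq_applySub] at h
  refine Formula.ClosedAt.of_applySub (fun n hn => ?_) h
  cases n with
  | zero => omega
  | succ n => exact absurd hn (Nat.not_lt_zero n)

theorem aconst_closed (i : ℕ) : (aconst L i).Closed := trivial

theorem Formula.ClosedAt.mono {φ : Formula L} {k m : ℕ} (h : φ.ClosedAt k) (hkm : k ≤ m) :
    φ.ClosedAt m := by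
  rw [← φ.applySub_var]
  exact h.applySub fun n hn => lt_of_lt_of_le hn hkm

theorem Prf.sentence {Γ Δ : Set (Formula L.plus)} {φ : Formula L.plus} (h : Prf L Γ Δ φ) :
    φ.Sentence := by
  induction h with
  | hyp _ h => exact h
  | weaken _ _ _ ih => exact ih
  | topIntro => trivial
  | botElim h _ _ => exact h
  | andIntro _ _ ih₁ ih₂ => exact ⟨ih₁, ih₂⟩
  | andElimL _ ih => exact ih.1
  | andElimR _ ih => exact ih.2
  | orIntroL h _ ih => exact ⟨ih, h⟩
  | orIntroR h _ ih => exact ⟨h, ih⟩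
  | orElim _ _ _ _ ih _ => exact ih
  | impIntro h _ ih => exact ⟨h, ih⟩
  | impElim _ _ _ ih => exact ih.2
  | intTrans _ _ ih₁ ih₂ => exact ⟨ih₁.1, ih₂.2⟩
  | intAndIntro _ _ ih₁ ih₂ => exact ⟨ih₁.1, ih₁.2, ih₂.2⟩
  | intOrElim _ _ ih₁ ih₂ => exact ⟨⟨ih₁.1, ih₂.1⟩, ih₁.2⟩
  | intAllIntro h _ ih => exact ⟨h, ih.2⟩
  | intExElim h _ ih => exact ⟨ih.1, h⟩
  | allIntro _ _ _ _ _ _ ih => exact closedAt_one_of_subst0 ih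
  | allElim ht _ ih => exact sentence_subst0 ih ht
  | cd h _ ih => exact ⟨h, ih.2⟩
  | exIntro _ h _ _ => exact h
  | exElim _ _ _ _ _ _ _ _ _ ih => exact ih

theorem Term.eventually_not_occC (t : Term L.plus) :
    ∀ᶠ i : ℕ in Filter.atTop, ¬ t.OccC (Sum.inr i) := by
  induction t with
  | var n => exact Filter.Eventually.of_forall fun _ h => h
  | const c =>
    rcases c with c | j
    · exact Filter.Eventually.of_forall fun _ h => Sum.inl_ne_inr h
    · filter_upwards [Filter.eventually_gt_atTop j] with i hi h
      exact hi.ne (Sum.inr.inj h)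
  | func f ts ih =>
    filter_upwards [Filter.eventually_all.2 ih] with i hi h
    exact h.elim hi

theorem Formula.eventually_not_occC (φ : Formula L.plus) :
    ∀ᶠ i : ℕ in Filter.atTop, ¬ φ.OccC (Sum.inr i) := by
  induction φ with
  | top => exact Filter.Eventually.of_forall fun _ h => h
  | bot => exact Filter.Eventually.of_forall fun _ h => h
  | rel R ts =>
    filter_upwards [Filter.eventually_all.2 fun j => (ts j).eventually_not_occC] with i hi h
    exact h.elim hi
  | and φ ψ ih₁ ih₂ => filter_upwards [ih₁, ih₂] with i h₁ h₂ h using h.elim h₁ h₂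
  | or φ ψ ih₁ ih₂ => filter_upwards [ih₁, ih₂] with i h₁ h₂ h using h.elim h₁ h₂
  | imp φ ψ ih₁ ih₂ => filter_upwards [ih₁, ih₂] with i h₁ h₂ h using h.elim h₁ h₂
  | all φ ih => exact ih
  | ex φ ih => exact ih

theorem Term.not_occC_emb (i : ℕ) (t : Term L) : ¬ t.emb.OccC (Sum.inr i) := by
  induction t with
  | var n => exact fun h => h
  | const c => exact fun h => Sum.inl_ne_inr h
  | func f ts ih => exact fun h => h.elim ih

theorem Formula.not_occC_emb (i : ℕ) (φ : Formula L) : ¬ φ.emb.OccC (Sum.inr i) := by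
  induction φ with
  | top => exact fun h => h
  | bot => exact fun h => h
  | rel R ts => exact fun h => h.elim fun j => (ts j).not_occC_emb i
  | and φ ψ ih₁ ih₂ => exact fun h => h.elim ih₁ ih₂
  | or φ ψ ih₁ ih₂ => exact fun h => h.elim ih₁ ih₂
  | imp φ ψ ih₁ ih₂ => exact fun h => h.elim ih₁ ih₂
  | all φ ih => exact ih
  | ex φ ih => exact ih

theorem Term.ClosedAt.emb {t : Term L} {k : ℕ} (h : t.ClosedAt k) : t.emb.ClosedAt k := by
  induction t with
  | var n => exact h
  | const c => trivial
  | func f ts ih => exact fun i => ih i (h i)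

theorem Formula.ClosedAt.emb {φ : Formula L} {k : ℕ} (h : φ.ClosedAt k) :
    φ.emb.ClosedAt k := by
  induction φ generalizing k with
  | top => trivial
  | bot => trivial
  | rel R ts => exact fun i => (h i).emb
  | and φ ψ ih₁ ih₂ => exact ⟨ih₁ h.1, ih₂ h.2⟩
  | or φ ψ ih₁ ih₂ => exact ⟨ih₁ h.1, ih₂ h.2⟩
  | imp φ ψ ih₁ ih₂ => exact ⟨ih₁ h.1, ih₂ h.2⟩
  | all φ ih => exact ih h
  | ex φ ih => exact ih h

theorem sentence_boxN {n : ℕ} {φ : Formula L} : (boxN n φ).Sentence ↔ φ.Sentence := by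
  induction n with
  | zero => exact Iff.rfl
  | succ n ih => exact ⟨fun h => ih.1 h.2, fun h => ⟨trivial, ih.2 h⟩⟩

theorem subst0_boxN (n : ℕ) (φ : Formula L) (t : Term L) :
    subst0 (boxN n φ) t = boxN n (subst0 φ t) := by
  induction n with
  | zero => rfl
  | succ n ih =>
    change Formula.imp .top (subst0 (boxN n φ) t) = _
    rw [ih]; rfl

theorem occC_of_occC_boxN {n : ℕ} {φ : Formula L} {c : L.Const} (h : (boxN n φ).OccC c) :
    φ.OccC c := by
  induction n with
  | zero => exact h
  | succ n ih => exact ih (h.resolve_left fun h => h)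

theorem boxN_imp_top (n : ℕ) (φ : Formula L) : boxN n (.imp .top φ) = boxN (n + 1) φ := by
  induction n with
  | zero => rfl
  | succ n ih => exact congrArg (Formula.imp .top) ih

namespace Prf

variable {Γ Δ : Set (Formula L.plus)} {φ ψ χ θ : Formula L.plus}

theorem self (h : φ.Sentence) : Prf L Γ {φ} φ :=
  hyp (Or.inr rfl) h

theorem imp_of_singleton (hφ : φ.Sentence) (h : Prf L Γ {φ} ψ) : Prf L Γ ∅ (.imp φ ψ) :=
  impIntro hφ (weaken subset_rfl (by simp) h)

theorem cut (h₁ : Prf L Γ Δ φ) (h₂ : Prf L Γ {φ} ψ) : Prf L Γ Δ ψ :=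
  impElim h₁ (imp_of_singleton h₁.sentence h₂)

theorem trans (h₁ : Prf L Γ Δ φ) (h₂ : Prf L ∅ {φ} ψ) : Prf L Γ Δ ψ :=
  h₁.cut (weaken (Set.empty_subset _) subset_rfl h₂)

theorem imp_of_empty (hφ : φ.Sentence) (h : Prf L ∅ {φ} ψ) : Prf L Γ Δ (.imp φ ψ) :=
  weaken (Set.empty_subset _) (Set.empty_subset _) (imp_of_singleton hφ h)

theorem box (h : Prf L Γ Δ φ) : Prf L Γ Δ (.imp .top φ) :=
  impIntro trivial (weaken subset_rfl (Set.subset_insert _ _) h)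

theorem boxN_mono {n : ℕ} (h : Prf L Γ Δ (boxN n φ)) (h' : Prf L Γ {φ} ψ) :
    Prf L Γ Δ (boxN n ψ) := by
  induction n generalizing Δ with
  | zero => exact h.cut h'
  | succ n ih =>
    have hs := h.sentence.2
    exact intTrans h (weaken subset_rfl (Set.empty_subset _) (imp_of_singleton hs (ih (self hs))))

theorem boxN_and {n : ℕ} (h₁ : Prf L Γ Δ (boxN n φ)) (h₂ : Prf L Γ Δ (boxN n ψ)) :
    Prf L Γ Δ (boxN n (.and φ ψ)) := by
  induction n generalizing Δ with
  | zero => exact andIntro h₁ h₂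
  | succ n ih =>
    have h := intAndIntro h₁ h₂
    have hs := h.sentence.2
    exact intTrans h (weaken subset_rfl (Set.empty_subset _)
      (imp_of_singleton hs (ih (andElimL (self hs)) (andElimR (self hs)))))

theorem boxN_le {n m : ℕ} (hnm : n ≤ m) (h : Prf L Γ Δ (boxN n φ)) :
    Prf L Γ Δ (boxN m φ) := by
  induction m, hnm using Nat.le_induction with
  | base => exact h
  | succ m _ ih => exact ih.box

theorem exists_boxN_and {n m : ℕ} (h₁ : Prf L Γ Δ (boxN n φ)) (h₂ : Prf L Γ Δ (boxN m ψ)) :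
    ∃ k, Prf L Γ Δ (boxN k (.and φ ψ)) :=
  ⟨max n m, boxN_and (boxN_le (le_max_left _ _) h₁) (boxN_le (le_max_right _ _) h₂)⟩

theorem exists_boxN_mp {n m : ℕ} (h₁ : Prf L Γ Δ (boxN n φ))
    (h₂ : Prf L Γ Δ (boxN m (.imp φ ψ))) : ∃ k, Prf L Γ Δ (boxN k ψ) := by
  obtain ⟨k, hk⟩ := exists_boxN_and h₁ h₂
  have hs := sentence_boxN.1 hk.sentence
  refine ⟨k + 1, ?_⟩
  rw [← boxN_imp_top]
  exact boxN_mono hk (intTrans (andElimL (self hs)).box (andElimR (self hs)))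

theorem of_boxN {n : ℕ} (h : Prf L Γ ∅ (boxN n φ)) : Prf L Γ ∅ φ := by
  induction n with
  | zero => exact h
  | succ n ih => exact ih (impElim topIntro h)

theorem boxN_all {n : ℕ} (h : Prf L Γ Δ (.all (boxN n φ))) : Prf L Γ Δ (boxN n (.all φ)) := by
  induction n generalizing Δ with
  | zero => exact h
  | succ n ih =>
    have h' : Prf L Γ Δ (.imp .top (.all (boxN n φ))) := intAllIntro trivial h
    have hs := h'.sentence.2
    exact intTrans h' (weaken subset_rfl (Set.empty_subset _)
      (imp_of_singleton hs (ih (self hs))))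

theorem and_or_distrib (h : (Formula.and φ (.or ψ χ)).Sentence) :
    Prf L ∅ {.and φ (.or ψ χ)} (.or (.and φ ψ) (.and φ χ)) := by
  have hφ : φ.Sentence := h.1
  have hψ : ψ.Sentence := h.2.1
  have hχ : χ.Sentence := h.2.2
  have e : ∀ θ : Formula L.plus, Prf L ∅ (insert θ {.and φ (.or ψ χ)}) φ := fun θ =>
    weaken subset_rfl (Set.subset_insert _ _) (andElimL (self h))
  exact orElim (andElimR (self h))
    (orIntroL ⟨hφ, hχ⟩ (andIntro (e ψ) (hyp (by simp) hψ)))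
    (orIntroR ⟨hφ, hψ⟩ (andIntro (e χ) (hyp (by simp) hχ)))

theorem or_elim_of_singleton (h : Prf L Γ Δ (.or φ ψ)) (h₁ : Prf L Γ {φ} χ)
    (h₂ : Prf L Γ {ψ} χ) : Prf L Γ Δ χ :=
  orElim h (weaken subset_rfl (by simp) h₁) (weaken subset_rfl (by simp) h₂)

theorem ex_elim {i : ℕ} (h : Prf L Γ Δ (.ex φ)) (hΓ : FreshIn i Γ)
    (hφ : ¬ φ.OccC (Sum.inr i)) (hψ : ¬ ψ.OccC (Sum.inr i))
    (h' : Prf L Γ {subst0 φ (aconst L i)} ψ) : Prf L Γ Δ ψ :=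
  exElim subset_rfl (Set.empty_subset _) hΓ (fun _ h => h.elim) hφ hψ h
    (weaken subset_rfl (by simp) h')

theorem and_ex (h : (Formula.and φ (.ex ψ)).Sentence) :
    Prf L ∅ {.and φ (.ex ψ)} (.ex (.and φ ψ)) := by
  obtain ⟨i, hi₁, hi₂⟩ := (φ.eventually_not_occC.and ψ.eventually_not_occC).exists
  have hφ : φ.Sentence := h.1
  have hs : (Formula.ex (.and φ ψ)).Sentence := ⟨hφ.mono (Nat.zero_le _), h.2⟩
  refine exElim subset_rfl subset_rfl (fun _ h => h.elim) ?_ hi₂ ?_ (andElimR (self h)) ?_ (i := i)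
  · rintro _ rfl
    rintro (h | h)
    exacts [hi₁ h, hi₂ h]
  · rintro (h | h)
    exacts [hi₁ h, hi₂ h]
  · refine exIntro (aconst_closed i) hs ?_
    change Prf L _ _ (.and (subst0 φ _) (subst0 ψ _))
    rw [hφ.subst0_eq]
    exact andIntro (weaken subset_rfl (Set.subset_insert _ _) (andElimL (self h)))
      (hyp (by simp) (sentence_subst0 h.2 (aconst_closed i)))

theorem imp_exportation (h : (Formula.imp (.and φ ψ) χ).Sentence) :
    Prf L ∅ {.imp (.and φ ψ) χ} (.imp φ (.imp ψ χ)) := by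
  have hφ : φ.Sentence := h.1.1
  have hψ : ψ.Sentence := h.1.2
  exact impIntro hφ (intTrans
    (impIntro hψ (andIntro (hyp (by simp) hφ) (hyp (by simp) hψ)))
    (hyp (by simp) h))

end Prf

/-- `A` is a conjunction of sentences from `Δ`. -/
inductive IsConj (Δ : Set (Formula L)) : Formula L → Prop
  | top : IsConj Δ .top
  | mem {φ} : φ ∈ Δ → φ.Sentence → IsConj Δ φ
  | and {φ ψ} : IsConj Δ φ → IsConj Δ ψ → IsConj Δ (.and φ ψ)

namespace IsConj

theorem sentence {Δ : Set (Formula L)} {A : Formula L} (h : IsConj Δ A) : A.Sentence := by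
  induction h with
  | top => trivial
  | mem _ h => exact h
  | and _ _ ih₁ ih₂ => exact ⟨ih₁, ih₂⟩

theorem mono {Δ Δ' : Set (Formula L)} {A : Formula L} (hΔ : Δ ⊆ Δ') (h : IsConj Δ A) :
    IsConj Δ' A := by
  induction h with
  | top => exact top
  | mem h hs => exact mem (hΔ h) hs
  | and _ _ ih₁ ih₂ => exact and ih₁ ih₂

variable {Δ : Set (Formula L.plus)} {A φ : Formula L.plus}

theorem prf {Γ : Set (Formula L.plus)} (h : IsConj Δ A) : Prf L Γ Δ A := by
  induction h with
  | top => exact .topIntro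
  | mem h hs => exact .hyp (Or.inr h) hs
  | and _ _ ih₁ ih₂ => exact .andIntro ih₁ ih₂

theorem not_occC {i : ℕ} (hi : FreshIn i Δ) (h : IsConj Δ A) : ¬ A.OccC (Sum.inr i) := by
  induction h with
  | top => exact fun h => h
  | mem h _ => exact hi _ h
  | and _ _ ih₁ ih₂ => exact fun h => h.elim ih₁ ih₂

theorem exists_of_insert (h : IsConj (insert φ Δ) A) (hφ : φ.Sentence) :
    ∃ B, IsConj Δ B ∧ Prf L ∅ {.and B φ} A := by
  induction h with
  | top => exact ⟨.top, top, .topIntro⟩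
  | @mem ψ h hs =>
    rcases h with rfl | h
    · exact ⟨.top, top, .andElimR (.self ⟨trivial, hφ⟩)⟩
    · exact ⟨ψ, mem h hs, .andElimL (.self ⟨hs, hφ⟩)⟩
  | and _ _ ih₁ ih₂ =>
    obtain ⟨B, hB, pB⟩ := ih₁
    obtain ⟨C, hC, pC⟩ := ih₂
    have hs : (Formula.and (.and B C) φ).Sentence := ⟨⟨hB.sentence, hC.sentence⟩, hφ⟩
    have p := Prf.self (Γ := ∅) hs
    exact ⟨.and B C, and hB hC, .andIntro
      ((Prf.andIntro (.andElimL (.andElimL p)) (.andElimR p)).trans pB)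
      ((Prf.andIntro (.andElimR (.andElimL p)) (.andElimR p)).trans pC)⟩

end IsConj

/-- Some `□ⁿ(A → ψ)`, with `A` a conjunction of sentences from `Δ`, has a proof with
unsafe assumptions from `Γ` and safe assumptions from `X`. -/
def BoxPrf (Γ X Δ : Set (Formula L.plus)) (ψ : Formula L.plus) : Prop :=
  ∃ A n, IsConj Δ A ∧ Prf L Γ X (boxN n (.imp A ψ))

namespace BoxPrf

variable {Γ X Δ : Set (Formula L.plus)} {φ ψ χ : Formula L.plus}

theorem mono {Γ' X' Δ' : Set (Formula L.plus)} (hΓ : Γ ⊆ Γ') (hX : X ⊆ X') (hΔ : Δ ⊆ Δ')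
    (h : BoxPrf Γ X Δ ψ) : BoxPrf Γ' X' Δ' ψ := by
  obtain ⟨A, n, hA, p⟩ := h
  exact ⟨A, n, hA.mono hΔ, p.weaken hΓ hX⟩

theorem of_prf (h : Prf L Γ X ψ) : BoxPrf Γ X Δ ψ :=
  ⟨.top, 0, .top, h.box⟩

theorem map (h : BoxPrf Γ X Δ φ) (h' : Prf L ∅ {φ} ψ) : BoxPrf Γ X Δ ψ := by
  obtain ⟨A, n, hA, p⟩ := h
  have hs := sentence_boxN.1 p.sentence
  exact ⟨A, n, hA, p.boxN_mono (.intTrans (.self hs) (.imp_of_empty hs.2 h'))⟩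

theorem pair (h₁ : BoxPrf Γ X Δ φ) (h₂ : BoxPrf Γ X Δ ψ) : BoxPrf Γ X Δ (.and φ ψ) := by
  obtain ⟨A, n, hA, p⟩ := h₁
  obtain ⟨B, m, hB, q⟩ := h₂
  obtain ⟨k, r⟩ := p.exists_boxN_and q
  have hs := sentence_boxN.1 r.sentence
  have hAB : (Formula.and A B).Sentence := ⟨hA.sentence, hB.sentence⟩
  exact ⟨.and A B, k, .and hA hB, r.boxN_mono (.intAndIntro
    (.intTrans (.imp_of_empty hAB (.andElimL (.self hAB))) (.andElimL (.self hs)))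
    (.intTrans (.imp_of_empty hAB (.andElimR (.self hAB))) (.andElimR (.self hs))))⟩

theorem exists_boxN (h : BoxPrf Γ X ∅ φ) : ∃ n, Prf L Γ X (boxN n φ) := by
  obtain ⟨A, n, hA, p⟩ := h
  exact Prf.exists_boxN_mp (n := 0) (hA.prf.weaken subset_rfl (Set.empty_subset _)) p

theorem mp (h₁ : BoxPrf Γ X Δ φ) (h₂ : BoxPrf Γ X ∅ (.imp φ ψ)) : BoxPrf Γ X Δ ψ := by
  obtain ⟨A, n, hA, p⟩ := h₁
  obtain ⟨m, q⟩ := h₂.exists_boxN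
  obtain ⟨k, r⟩ := p.exists_boxN_and q
  have hs := sentence_boxN.1 r.sentence
  exact ⟨A, k, hA, r.boxN_mono (.intTrans (.andElimL (.self hs)) (.andElimR (.self hs)))⟩

theorem exists_of_insert (h : BoxPrf Γ X (insert φ Δ) ψ) (hφ : φ.Sentence) :
    ∃ A n, IsConj Δ A ∧ Prf L Γ X (boxN n (.imp (.and A φ) ψ)) := by
  obtain ⟨A, n, hA, p⟩ := h
  obtain ⟨B, hB, q⟩ := hA.exists_of_insert hφ
  have hs := sentence_boxN.1 p.sentence
  exact ⟨B, n, hB, p.boxN_mono (.intTrans (.imp_of_empty ⟨hB.sentence, hφ⟩ q) (.self hs))⟩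

theorem impIntro (h : BoxPrf Γ X (insert φ Δ) ψ) (hφ : φ.Sentence) :
    BoxPrf Γ X Δ (.imp φ ψ) := by
  obtain ⟨A, n, hA, p⟩ := h.exists_of_insert hφ
  have hs := sentence_boxN.1 p.sentence
  exact ⟨A, n, hA, p.boxN_mono (.weaken (Set.empty_subset _) subset_rfl (.imp_exportation hs))⟩

/-- Applying a sentence `A ∧ φ → ψ` (with `A` from `Δ`) to `φ` costs no box. -/
theorem app {A : Formula L.plus} {n : ℕ} (h : BoxPrf Γ X Δ φ) (hA : IsConj Δ A)
    (p : Prf L Γ X (boxN n (.imp (.and A φ) ψ))) : BoxPrf Γ X Δ ψ := by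
  obtain ⟨B, m, hB, q⟩ := h
  obtain ⟨k, r⟩ := q.exists_boxN_and p
  have hs := sentence_boxN.1 r.sentence
  have hBA : (Formula.and B A).Sentence := ⟨hB.sentence, hA.sentence⟩
  exact ⟨.and B A, k, .and hB hA, r.boxN_mono (.intTrans (.intAndIntro
    (.imp_of_empty hBA (.andElimR (.self hBA)))
    (.intTrans (.imp_of_empty hBA (.andElimL (.self hBA))) (.andElimL (.self hs))))
    (.andElimR (.self hs)))⟩

theorem orElim (h : BoxPrf Γ X Δ (.or φ ψ)) (hφ : φ.Sentence) (hψ : ψ.Sentence)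
    (h₁ : BoxPrf Γ X (insert φ Δ) χ) (h₂ : BoxPrf Γ X (insert ψ Δ) χ) : BoxPrf Γ X Δ χ := by
  obtain ⟨A, n, hA, p⟩ := h₁.exists_of_insert hφ
  obtain ⟨B, m, hB, q⟩ := h₂.exists_of_insert hψ
  obtain ⟨k, r⟩ := p.exists_boxN_and q
  have hs := sentence_boxN.1 r.sentence
  have hAB : (Formula.and A B).Sentence := ⟨hA.sentence, hB.sentence⟩
  have h₁ : (Formula.and (.and A B) φ).Sentence := ⟨hAB, hφ⟩
  have h₂ : (Formula.and (.and A B) ψ).Sentence := ⟨hAB, hψ⟩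
  refine h.app (.and hA hB) (r.boxN_mono (n := k) (.intTrans
    (.imp_of_empty ⟨hAB, hφ, hψ⟩ (.and_or_distrib ⟨hAB, hφ, hψ⟩)) (.intOrElim
      (.intTrans (.imp_of_empty h₁ ?_) (.andElimL (.self hs)))
      (.intTrans (.imp_of_empty h₂ ?_) (.andElimR (.self hs))))))
  · exact .andIntro (.andElimL (.andElimL (.self h₁))) (.andElimR (.self h₁))
  · exact .andIntro (.andElimR (.andElimL (.self h₂))) (.andElimR (.self h₂))

end BoxPrf

theorem FreshIn.mono {Γ Γ' : Set (Formula L.plus)} {i : ℕ} (h : FreshIn i Γ') (hΓ : Γ ⊆ Γ') :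
    FreshIn i Γ := fun ψ hψ => h ψ (hΓ hψ)

theorem FreshIn.empty (i : ℕ) : FreshIn (L := L) i ∅ := fun _ h => h.elim

/-- Assumptions used unsafely can be made safe at the price of boxing the conclusion. -/
theorem Prf.boxPrf {Γ Δ : Set (Formula L.plus)} {φ : Formula L.plus} (h : Prf L Γ Δ φ)
    (X : Set (Formula L.plus)) : BoxPrf (Γ \ X) (Γ ∩ X) Δ φ := by
  induction h with
  | @hyp Γ Δ φ h hs =>
    rcases h with h | h
    · refine .of_prf (.hyp ?_ hs)
      by_cases hX : φ ∈ X
      exacts [Or.inr ⟨h, hX⟩, Or.inl ⟨h, hX⟩]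
    · exact ⟨φ, 0, .mem h hs, .imp_of_empty hs (.self hs)⟩
  | weaken hΓ hΔ _ ih =>
    exact ih.mono (Set.sdiff_subset_sdiff_left hΓ) (Set.inter_subset_inter_left _ hΓ) hΔ
  | topIntro => exact .of_prf .topIntro
  | botElim hs _ ih => exact ih.map (.botElim hs (.self trivial))
  | andIntro _ _ ih₁ ih₂ => exact ih₁.pair ih₂
  | andElimL h ih => exact ih.map (.andElimL (.self h.sentence))
  | andElimR h ih => exact ih.map (.andElimR (.self h.sentence))
  | orIntroL hs h ih => exact ih.map (.orIntroL hs (.self h.sentence))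
  | orIntroR hs h ih => exact ih.map (.orIntroR hs (.self h.sentence))
  | orElim h _ _ ih ih₁ ih₂ => exact ih.orElim h.sentence.1 h.sentence.2 ih₁ ih₂
  | impIntro hs _ ih => exact ih.impIntro hs
  | impElim _ _ ih₁ ih₂ => exact ih₁.mp ih₂
  | intTrans h₁ h₂ ih₁ ih₂ =>
    have hs := And.intro h₁.sentence h₂.sentence
    exact (ih₁.pair ih₂).map (.intTrans (.andElimL (.self hs)) (.andElimR (.self hs)))
  | intAndIntro h₁ h₂ ih₁ ih₂ =>
    have hs := And.intro h₁.sentence h₂.sentence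
    exact (ih₁.pair ih₂).map (.intAndIntro (.andElimL (.self hs)) (.andElimR (.self hs)))
  | intOrElim h₁ h₂ ih₁ ih₂ =>
    have hs := And.intro h₁.sentence h₂.sentence
    exact (ih₁.pair ih₂).map (.intOrElim (.andElimL (.self hs)) (.andElimR (.self hs)))
  | intAllIntro hs h ih => exact ih.map (.intAllIntro hs (.self h.sentence))
  | intExElim hs h ih => exact ih.map (.intExElim hs (.self h.sentence))
  | allElim ht h ih => exact ih.map (.allElim ht (.self h.sentence))
  | cd hs h ih => exact ih.map (.cd hs (.self h.sentence))
  | exIntro ht hs h ih => exact ih.map (.exIntro ht hs (.self h.sentence))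
  | @allIntro Γ Δ Γ' Δ' φ i hΓ hΔ hiΓ hiΔ hiφ h ih =>
    obtain ⟨A, n, hA, p⟩ := ih
    refine BoxPrf.mono (Set.sdiff_subset_sdiff_left hΓ) (Set.inter_subset_inter_left _ hΓ) hΔ
      ⟨A, n, hA, ?_⟩
    have p' : Prf L (Γ' \ X) (Γ' ∩ X) (.all (boxN n (.imp A φ))) := by
      refine .allIntro (i := i) subset_rfl subset_rfl (hiΓ.mono Set.sdiff_subset)
        (hiΓ.mono Set.inter_subset_left) (fun h => ?_) ?_
      · exact (occC_of_occC_boxN h).elim (hA.not_occC hiΔ) hiφ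
      · rw [subst0_boxN]
        change Prf L _ _ (boxN n (.imp (subst0 A _) (subst0 φ _)))
        rwa [hA.sentence.subst0_eq]
    exact p'.boxN_all.boxN_mono
      (.intAllIntro hA.sentence (.self (sentence_boxN.1 p'.boxN_all.sentence)))
  | @exElim Γ Δ Γ' Δ' φ ψ i hΓ hΔ hiΓ hiΔ hiφ hiψ h h' ih ih' =>
    have hφ : φ.ClosedAt 1 := h.sentence
    obtain ⟨A, n, hA, p⟩ := ih'.exists_of_insert (sentence_subst0 hφ (aconst_closed i))
    have p' : Prf L (Γ' \ X) (Γ' ∩ X) (.all (boxN n (.imp (.and A φ) ψ))) := by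
      refine .allIntro (i := i) subset_rfl subset_rfl (hiΓ.mono Set.sdiff_subset)
        (hiΓ.mono Set.inter_subset_left) (fun h => ?_) ?_
      · exact (occC_of_occC_boxN h).elim (fun h => h.elim (hA.not_occC hiΔ) hiφ) hiψ
      · rw [subst0_boxN]
        change Prf L _ _ (boxN n (.imp (.and (subst0 A _) (subst0 φ _)) (subst0 ψ _)))
        rwa [hA.sentence.subst0_eq, h'.sentence.subst0_eq]
    have hs : (Formula.and A (.ex φ)).Sentence := ⟨hA.sentence, h.sentence⟩
    refine ih.app (hA.mono hΔ) (n := n) (Prf.weaken (Set.sdiff_subset_sdiff_left hΓ)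
      (Set.inter_subset_inter_left _ hΓ) (p'.boxN_all.boxN_mono (.intTrans
        (.imp_of_empty hs (.and_ex hs))
        (.intExElim h'.sentence (.self (sentence_boxN.1 p'.boxN_all.sentence))))))

namespace Prf

variable {Γ Δ : Set (Formula L.plus)} {φ ψ χ : Formula L.plus}

theorem exists_isConj (h : Prf L Γ Δ φ) : ∃ A, IsConj Δ A ∧ Prf L Γ ∅ (.imp A φ) := by
  obtain ⟨A, n, hA, p⟩ := h.boxPrf ∅
  exact ⟨A, hA, of_boxN (n := n) (p.weaken (by simp) (by simp))⟩

theorem exists_boxN_of_insert (h : Prf L (insert χ Γ) ∅ φ) :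
    ∃ n, Prf L Γ {χ} (boxN n φ) := by
  obtain ⟨n, p⟩ := (h.boxPrf {χ}).exists_boxN
  exact ⟨n, p.weaken (by simp) (by simp)⟩

theorem exists_isConj_boxN (h : Prf L Γ ∅ φ) :
    ∃ A n, IsConj Γ A ∧ Prf L ∅ ∅ (.imp A (boxN n φ)) := by
  obtain ⟨n, p⟩ := (h.boxPrf Set.univ).exists_boxN
  obtain ⟨A, hA, q⟩ := p.exists_isConj
  exact ⟨A, n, hA.mono Set.inter_subset_left, q.weaken (by simp) subset_rfl⟩

end Prf

/-- All symbols of the term belong to `S`. -/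
def Term.SymIn (S : Set (L.Const ⊕ L.Func ⊕ L.Rel)) : Term L → Prop
  | .var _ => True
  | .const c => Sum.inl c ∈ S
  | .func f ts => Sum.inr (Sum.inl f) ∈ S ∧ ∀ i, (ts i).SymIn S

/-- All symbols of the formula belong to `S`. -/
def Formula.SymIn (S : Set (L.Const ⊕ L.Func ⊕ L.Rel)) : Formula L → Prop
  | .top => True
  | .bot => True
  | .rel R ts => Sum.inr (Sum.inr R) ∈ S ∧ ∀ i, (ts i).SymIn S
  | .and φ ψ => φ.SymIn S ∧ ψ.SymIn S
  | .or φ ψ => φ.SymIn S ∧ ψ.SymIn S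
  | .imp φ ψ => φ.SymIn S ∧ ψ.SymIn S
  | .all φ => φ.SymIn S
  | .ex φ => φ.SymIn S

section SymIn

variable {S T : Set (L.Const ⊕ L.Func ⊕ L.Rel)}

theorem Term.SymIn.mono (h : S ⊆ T) {t : Term L} (ht : t.SymIn S) : t.SymIn T := by
  induction t with
  | var n => trivial
  | const c => exact h ht
  | func f ts ih => exact ⟨h ht.1, fun i => ih i (ht.2 i)⟩

theorem Formula.SymIn.mono (h : S ⊆ T) {φ : Formula L} (hφ : φ.SymIn S) : φ.SymIn T := by
  induction φ with
  | top => trivial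
  | bot => trivial
  | rel R ts => exact ⟨h hφ.1, fun i => (hφ.2 i).mono h⟩
  | and φ ψ ih₁ ih₂ => exact ⟨ih₁ hφ.1, ih₂ hφ.2⟩
  | or φ ψ ih₁ ih₂ => exact ⟨ih₁ hφ.1, ih₂ hφ.2⟩
  | imp φ ψ ih₁ ih₂ => exact ⟨ih₁ hφ.1, ih₂ hφ.2⟩
  | all φ ih => exact ih hφ
  | ex φ ih => exact ih hφ

theorem Term.exists_countable_symIn (t : Term L) :
    ∃ S : Set (L.Const ⊕ L.Func ⊕ L.Rel), S.Countable ∧ t.SymIn S := by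
  induction t with
  | var n => exact ⟨∅, Set.countable_empty, trivial⟩
  | const c => exact ⟨{Sum.inl c}, Set.countable_singleton _, rfl⟩
  | func f ts ih =>
    choose S hS ht using ih
    exact ⟨insert (Sum.inr (Sum.inl f)) (⋃ i, S i), (Set.countable_iUnion hS).insert _,
      Set.mem_insert _ _, fun i =>
        (ht i).mono ((Set.subset_iUnion S i).trans (Set.subset_insert _ _))⟩

theorem Formula.exists_countable_symIn (φ : Formula L) :
    ∃ S : Set (L.Const ⊕ L.Func ⊕ L.Rel), S.Countable ∧ φ.SymIn S := by
  induction φ with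
  | top => exact ⟨∅, Set.countable_empty, trivial⟩
  | bot => exact ⟨∅, Set.countable_empty, trivial⟩
  | rel R ts =>
    choose S hS ht using fun i => (ts i).exists_countable_symIn
    exact ⟨insert (Sum.inr (Sum.inr R)) (⋃ i, S i), (Set.countable_iUnion hS).insert _,
      Set.mem_insert _ _, fun i =>
        (ht i).mono ((Set.subset_iUnion S i).trans (Set.subset_insert _ _))⟩
  | and φ ψ ih₁ ih₂ =>
    obtain ⟨S, hS, h₁⟩ := ih₁
    obtain ⟨T, hT, h₂⟩ := ih₂
    exact ⟨S ∪ T, hS.union hT, h₁.mono Set.subset_union_left, h₂.mono Set.subset_union_right⟩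
  | or φ ψ ih₁ ih₂ =>
    obtain ⟨S, hS, h₁⟩ := ih₁
    obtain ⟨T, hT, h₂⟩ := ih₂
    exact ⟨S ∪ T, hS.union hT, h₁.mono Set.subset_union_left, h₂.mono Set.subset_union_right⟩
  | imp φ ψ ih₁ ih₂ =>
    obtain ⟨S, hS, h₁⟩ := ih₁
    obtain ⟨T, hT, h₂⟩ := ih₂
    exact ⟨S ∪ T, hS.union hT, h₁.mono Set.subset_union_left, h₂.mono Set.subset_union_right⟩
  | all φ ih => exact ih
  | ex φ ih => exact ih

theorem Term.SymIn.shiftUp {t : Term L} (ht : t.SymIn S) : t.shiftUp.SymIn S := by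
  induction t with
  | var n => trivial
  | const c => exact ht
  | func f ts ih => exact ⟨ht.1, fun i => ih i (ht.2 i)⟩

theorem Term.SymIn.applySub {σ : ℕ → Term L} (hσ : ∀ n, (σ n).SymIn S) {t : Term L}
    (ht : t.SymIn S) : (t.applySub σ).SymIn S := by
  induction t with
  | var n => exact hσ n
  | const c => exact ht
  | func f ts ih => exact ⟨ht.1, fun i => ih i (ht.2 i)⟩

theorem Formula.SymIn.applySub {σ : ℕ → Term L} (hσ : ∀ n, (σ n).SymIn S) {φ : Formula L}
    (hφ : φ.SymIn S) : (φ.applySub σ).SymIn S := by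
  have lift : ∀ {σ : ℕ → Term L}, (∀ n, (σ n).SymIn S) → ∀ n, (liftSub σ n).SymIn S := by
    intro σ h n
    cases n with
    | zero => trivial
    | succ n => exact (h n).shiftUp
  induction φ generalizing σ with
  | top => trivial
  | bot => trivial
  | rel R ts => exact ⟨hφ.1, fun i => (hφ.2 i).applySub hσ⟩
  | and φ ψ ih₁ ih₂ => exact ⟨ih₁ hσ hφ.1, ih₂ hσ hφ.2⟩
  | or φ ψ ih₁ ih₂ => exact ⟨ih₁ hσ hφ.1, ih₂ hσ hφ.2⟩
  | imp φ ψ ih₁ ih₂ => exact ⟨ih₁ hσ hφ.1, ih₂ hσ hφ.2⟩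
  | all φ ih => exact ih (lift hσ) hφ
  | ex φ ih => exact ih (lift hσ) hφ

/-- The terms over `S` of depth at most `n`. -/
def termStage (S : Set (L.Const ⊕ L.Func ⊕ L.Rel)) : ℕ → Set (Term L)
  | 0 => Set.range Term.var ∪ Term.const '' (Sum.inl ⁻¹' S)
  | n + 1 => termStage S n ∪ ⋃ f ∈ {f | Sum.inr (Sum.inl f) ∈ S},
      Term.func f '' Set.univ.pi fun _ => termStage S n

/-- The formulas over `S` of depth at most `n`. -/
def formulaStage (S : Set (L.Const ⊕ L.Func ⊕ L.Rel)) : ℕ → Set (Formula L)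
  | 0 => {.top, .bot} ∪ ⋃ R ∈ {R | Sum.inr (Sum.inr R) ∈ S},
      Formula.rel R '' Set.univ.pi fun _ => {t | t.SymIn S}
  | n + 1 => formulaStage S n ∪ (Set.image2 .and (formulaStage S n) (formulaStage S n) ∪
      Set.image2 .or (formulaStage S n) (formulaStage S n) ∪
      Set.image2 .imp (formulaStage S n) (formulaStage S n) ∪
      Formula.all '' formulaStage S n ∪ Formula.ex '' formulaStage S n)

theorem termStage_mono : Monotone (termStage S) :=
  monotone_nat_of_le_succ fun _ => Set.subset_union_left

theorem formulaStage_mono : Monotone (formulaStage S) :=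
  monotone_nat_of_le_succ fun _ => Set.subset_union_left

theorem countable_symIn_term (hS : S.Countable) : {t : Term L | t.SymIn S}.Countable := by
  have hc : ∀ n, (termStage S n).Countable := by
    intro n
    induction n with
    | zero =>
      exact (Set.countable_range _).union
        ((hS.preimage_of_injOn Sum.inl_injective.injOn).image _)
    | succ n ih =>
      refine ih.union (Set.Countable.biUnion ?_ fun f _ =>
        (Set.countable_univ_pi fun _ => ih).image _)
      exact hS.preimage_of_injOn (Sum.inr_injective.comp Sum.inl_injective).injOn
  refine (Set.countable_iUnion hc).mono fun t (ht : t.SymIn S) => ?_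
  rw [Set.mem_iUnion]
  induction t with
  | var n => exact ⟨0, Or.inl ⟨n, rfl⟩⟩
  | const c => exact ⟨0, Or.inr ⟨c, ht, rfl⟩⟩
  | func f ts ih =>
    choose n hn using fun i => ih i (ht.2 i)
    refine ⟨Finset.univ.sup n + 1, Or.inr (Set.mem_biUnion ht.1 ⟨ts, fun i _ => ?_, rfl⟩)⟩
    exact termStage_mono (Finset.le_sup (Finset.mem_univ i)) (hn i)

theorem countable_symIn_formula (hS : S.Countable) :
    {φ : Formula L | φ.SymIn S}.Countable := by
  have hc : ∀ n, (formulaStage S n).Countable := by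
    intro n
    induction n with
    | zero =>
      refine (Set.Countable.insert _ (Set.countable_singleton _)).union
        (Set.Countable.biUnion ?_ fun R _ =>
          (Set.countable_univ_pi fun _ => countable_symIn_term hS).image _)
      exact hS.preimage_of_injOn (Sum.inr_injective.comp Sum.inr_injective).injOn
    | succ n ih =>
      exact ih.union (((((ih.image2 ih _).union (ih.image2 ih _)).union
        (ih.image2 ih _)).union (ih.image _)).union (ih.image _))
  refine (Set.countable_iUnion hc).mono fun φ (hφ : φ.SymIn S) => ?_
  rw [Set.mem_iUnion]
  have two : ∀ {φ ψ : Formula L}, (∃ n, φ ∈ formulaStage S n) → (∃ n, ψ ∈ formulaStage S n) →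
      ∃ n, φ ∈ formulaStage S n ∧ ψ ∈ formulaStage S n := fun ⟨n, hn⟩ ⟨m, hm⟩ =>
    ⟨max n m, formulaStage_mono (le_max_left _ _) hn, formulaStage_mono (le_max_right _ _) hm⟩
  induction φ with
  | top => exact ⟨0, Or.inl (Or.inl rfl)⟩
  | bot => exact ⟨0, Or.inl (Or.inr rfl)⟩
  | rel R ts =>
    exact ⟨0, Or.inr (Set.mem_biUnion hφ.1 ⟨ts, fun i _ => hφ.2 i, rfl⟩)⟩
  | and φ ψ ih₁ ih₂ =>
    obtain ⟨n, h₁, h₂⟩ := two (ih₁ hφ.1) (ih₂ hφ.2)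
    exact ⟨n + 1, Or.inr (Or.inl (Or.inl (Or.inl (Or.inl (Set.mem_image2_of_mem h₁ h₂)))))⟩
  | or φ ψ ih₁ ih₂ =>
    obtain ⟨n, h₁, h₂⟩ := two (ih₁ hφ.1) (ih₂ hφ.2)
    exact ⟨n + 1, Or.inr (Or.inl (Or.inl (Or.inl (Or.inr (Set.mem_image2_of_mem h₁ h₂)))))⟩
  | imp φ ψ ih₁ ih₂ =>
    obtain ⟨n, h₁, h₂⟩ := two (ih₁ hφ.1) (ih₂ hφ.2)
    exact ⟨n + 1, Or.inr (Or.inl (Or.inl (Or.inr (Set.mem_image2_of_mem h₁ h₂))))⟩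
  | all φ ih =>
    obtain ⟨n, h⟩ := ih hφ
    exact ⟨n + 1, Or.inr (Or.inl (Or.inr (Set.mem_image_of_mem _ h)))⟩
  | ex φ ih =>
    obtain ⟨n, h⟩ := ih hφ
    exact ⟨n + 1, Or.inr (Or.inr (Set.mem_image_of_mem _ h))⟩

end SymIn

/-- The sentences over the symbols in `S`. -/
def sentencesOver (S : Set (L.Const ⊕ L.Func ⊕ L.Rel)) : Set (Formula L) :=
  {φ | φ.Sentence ∧ φ.SymIn S}

/-- The closed terms over the symbols in `S`. -/
def closedTermsOver (S : Set (L.Const ⊕ L.Func ⊕ L.Rel)) : Set (Term L) :=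
  {t | t.Closed ∧ t.SymIn S}

section sentencesOver

variable {S : Set (L.Const ⊕ L.Func ⊕ L.Rel)} {φ ψ : Formula L}

theorem and_mem_sentencesOver (h₁ : φ ∈ sentencesOver S) (h₂ : ψ ∈ sentencesOver S) :
    Formula.and φ ψ ∈ sentencesOver S := ⟨⟨h₁.1, h₂.1⟩, h₁.2, h₂.2⟩

theorem or_mem_sentencesOver (h₁ : φ ∈ sentencesOver S) (h₂ : ψ ∈ sentencesOver S) :
    Formula.or φ ψ ∈ sentencesOver S := ⟨⟨h₁.1, h₂.1⟩, h₁.2, h₂.2⟩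

theorem imp_mem_sentencesOver (h₁ : φ ∈ sentencesOver S) (h₂ : ψ ∈ sentencesOver S) :
    Formula.imp φ ψ ∈ sentencesOver S := ⟨⟨h₁.1, h₂.1⟩, h₁.2, h₂.2⟩

theorem top_mem_sentencesOver : Formula.top ∈ sentencesOver S := ⟨trivial, trivial⟩

theorem bot_mem_sentencesOver : Formula.bot ∈ sentencesOver S := ⟨trivial, trivial⟩

theorem subst0_mem_sentencesOver {t : Term L} (hφ : φ.ClosedAt 1) (hS : φ.SymIn S)
    (ht : t ∈ closedTermsOver S) : subst0 φ t ∈ sentencesOver S := by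
  refine ⟨sentence_subst0 hφ ht.1, ?_⟩
  rw [subst0_eq_applySub]
  refine hS.applySub fun n => ?_
  cases n with
  | zero => exact ht.2
  | succ n => trivial

theorem IsConj.mem_of_subset {Δ u : Set (Formula L)} {A : Formula L} (hA : IsConj Δ A)
    (hΔ : Δ ⊆ u) (htop : .top ∈ u) (hand : ∀ φ ψ, φ ∈ u → ψ ∈ u → .and φ ψ ∈ u) : A ∈ u := by
  induction hA with
  | top => exact htop
  | mem h _ => exact hΔ h
  | and _ _ ih₁ ih₂ => exact hand _ _ ih₁ ih₂

end sentencesOver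

section Lindenbaum

variable {S : Set (L.plus.Const ⊕ L.plus.Func ⊕ L.plus.Rel)}
  {E : Formula L.plus → Formula L.plus → Prop}

/-- A consequence relation between sentences over `S` that extends provability and for which
quantifiers are bounds of their instances over `S`. -/
structure IsConsequence (S : Set (L.plus.Const ⊕ L.plus.Func ⊕ L.plus.Rel))
    (E : Formula L.plus → Formula L.plus → Prop) : Prop where
  of_prf : ∀ {A B}, A ∈ sentencesOver S → B ∈ sentencesOver S → Prf L ∅ {A} B → E A B
  trans : ∀ {A B C}, E A B → E B C → E A C
  and : ∀ {A B C}, E C A → E C B → E C (.and A B)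
  or : ∀ {A B C}, E A C → E B C → E (.or A B) C
  ex : ∀ {A B}, .ex A ∈ sentencesOver S → B ∈ sentencesOver S →
    (∀ t ∈ closedTermsOver S, E (subst0 A t) B) → E (.ex A) B
  all : ∀ {A B}, .all B ∈ sentencesOver S → A ∈ sentencesOver S →
    (∀ t ∈ closedTermsOver S, E A (subst0 B t)) → E A (.all B)

/-- A prime set of sentences over `S` that has witnesses for both quantifiers. -/
structure IsSaturated (S : Set (L.plus.Const ⊕ L.plus.Func ⊕ L.plus.Rel))
    (u : Set (Formula L.plus)) : Prop where
  subset : u ⊆ sentencesOver S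
  top : .top ∈ u
  bot : .bot ∉ u
  and : ∀ φ ψ, φ ∈ u → ψ ∈ u → .and φ ψ ∈ u
  or : ∀ φ ψ, .or φ ψ ∈ u → φ ∈ u ∨ ψ ∈ u
  ex : ∀ φ, .ex φ ∈ u → ∃ t ∈ closedTermsOver S, subst0 φ t ∈ u
  all : ∀ φ, .all φ ∈ sentencesOver S → (∀ t ∈ closedTermsOver S, subst0 φ t ∈ u) → .all φ ∈ u

/-- Pairs of sentences `(A, B)` over `S` for which `E A B` fails. -/
def UnrelatedPair (S : Set (L.plus.Const ⊕ L.plus.Func ⊕ L.plus.Rel))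
    (E : Formula L.plus → Formula L.plus → Prop) : Type :=
  {p : sentencesOver S × sentencesOver S // ¬ E p.1 p.2}

namespace IsConsequence

variable (hE : IsConsequence S E)
include hE

theorem refl {A : Formula L.plus} (hA : A ∈ sentencesOver S) : E A A :=
  hE.of_prf hA hA (.self hA.1)

theorem and_left {A B : Formula L.plus} (hA : A ∈ sentencesOver S) (hB : B ∈ sentencesOver S) :
    E (.and A B) A :=
  hE.of_prf (and_mem_sentencesOver hA hB) hA (.andElimL (.self ⟨hA.1, hB.1⟩))

theorem and_right {A B : Formula L.plus} (hA : A ∈ sentencesOver S) (hB : B ∈ sentencesOver S) :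
    E (.and A B) B :=
  hE.of_prf (and_mem_sentencesOver hA hB) hB (.andElimR (.self ⟨hA.1, hB.1⟩))

theorem or_left {A B : Formula L.plus} (hA : A ∈ sentencesOver S) (hB : B ∈ sentencesOver S) :
    E A (.or A B) :=
  hE.of_prf hA (or_mem_sentencesOver hA hB) (.orIntroL hB.1 (.self hA.1))

theorem or_right {A B : Formula L.plus} (hA : A ∈ sentencesOver S) (hB : B ∈ sentencesOver S) :
    E B (.or A B) :=
  hE.of_prf hB (or_mem_sentencesOver hA hB) (.orIntroR hA.1 (.self hB.1))

theorem cut {A B χ : Formula L.plus} (hA : A ∈ sentencesOver S) (hB : B ∈ sentencesOver S)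
    (hχ : χ ∈ sentencesOver S) (h₁ : E (.and A χ) B) (h₂ : E A (.or B χ)) : E A B := by
  have h := and_mem_sentencesOver hA (or_mem_sentencesOver hB hχ)
  refine hE.trans (hE.and (hE.refl hA) h₂) (hE.trans (hE.of_prf h ?_ (.and_or_distrib h.1))
    (hE.or (hE.and_right hA hB) h₁))
  exact or_mem_sentencesOver (and_mem_sentencesOver hA hB) (and_mem_sentencesOver hA hχ)

theorem ex_and {A B χ : Formula L.plus} (hA : A ∈ sentencesOver S) (hB : B ∈ sentencesOver S)
    (hχ : .ex χ ∈ sentencesOver S)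
    (h : ∀ t ∈ closedTermsOver S, E (.and A (subst0 χ t)) B) : E (.and A (.ex χ)) B := by
  have hex : Formula.ex (.and A χ) ∈ sentencesOver S :=
    ⟨⟨hA.1.mono (Nat.zero_le _), hχ.1⟩, hA.2, hχ.2⟩
  refine hE.trans (hE.of_prf (and_mem_sentencesOver hA hχ) hex (.and_ex ⟨hA.1, hχ.1⟩))
    (hE.ex hex hB fun t ht => ?_)
  change E (.and (subst0 A t) (subst0 χ t)) B
  rw [hA.1.subst0_eq]
  exact h t ht

theorem all_or {A B χ : Formula L.plus} (hA : A ∈ sentencesOver S) (hB : B ∈ sentencesOver S)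
    (hχ : .all χ ∈ sentencesOver S)
    (h : ∀ t ∈ closedTermsOver S, E A (.or B (subst0 χ t))) : E A (.or B (.all χ)) := by
  have hall : Formula.all (.or B χ) ∈ sentencesOver S :=
    ⟨⟨hB.1.mono (Nat.zero_le _), hχ.1⟩, hB.2, hχ.2⟩
  refine hE.trans (hE.all hall hA fun t ht => ?_)
    (hE.of_prf hall (or_mem_sentencesOver hB hχ) (.cd hB.1 (.self hall.1)))
  change E A (.or (subst0 B t) (subst0 χ t))
  rw [hB.1.subst0_eq]
  exact h t ht

/-- Unrelated pairs, ordered by strengthening the left and weakening the right component. -/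
@[reducible] def preorder : Preorder (UnrelatedPair S E) where
  le p q := E q.1.1 p.1.1 ∧ E p.1.2 q.1.2
  le_refl p := ⟨hE.refl p.1.1.2, hE.refl p.1.2.2⟩
  le_trans _ _ _ h₁ h₂ := ⟨hE.trans h₂.1 h₁.1, hE.trans h₁.2 h₂.2⟩

theorem exists_decided (p : UnrelatedPair S E) (χ : sentencesOver S) :
    ∃ q : UnrelatedPair S E, (E q.1.1 p.1.1 ∧ E p.1.2 q.1.2) ∧
      ((E q.1.1 χ ∧ ∀ θ, χ.1 = .ex θ → ∃ t ∈ closedTermsOver S, E q.1.1 (subst0 θ t)) ∨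
        (E χ q.1.2 ∧ ∀ θ, χ.1 = .all θ → ∃ t ∈ closedTermsOver S, E (subst0 θ t) q.1.2)) := by
  obtain ⟨⟨⟨A, hA⟩, ⟨B, hB⟩⟩, hAB⟩ := p
  obtain ⟨χ, hχ⟩ := χ
  by_cases h : E (.and A χ) B
  · have h' : ¬ E A (.or B χ) := fun h' => hAB (hE.cut hA hB hχ h h')
    by_cases hall : ∃ θ, χ = .all θ
    · obtain ⟨θ, rfl⟩ := hall
      obtain ⟨t, ht, hn⟩ : ∃ t ∈ closedTermsOver S, ¬ E A (.or B (subst0 θ t)) := by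
        by_contra! hc
        exact h' (hE.all_or hA hB hχ hc)
      have hθ : subst0 θ t ∈ sentencesOver S := subst0_mem_sentencesOver hχ.1 hχ.2 ht
      have hr := hE.or_right hB hθ
      refine ⟨⟨⟨⟨A, hA⟩, ⟨_, or_mem_sentencesOver hB hθ⟩⟩, hn⟩,
        ⟨hE.refl hA, hE.or_left hB hθ⟩, Or.inr ⟨?_, ?_⟩⟩
      · exact hE.trans (hE.of_prf hχ hθ (.allElim ht.1 (.self hχ.1))) hr
      · intro θ' h'
        obtain rfl : θ = θ' := Formula.all.inj h'
        exact ⟨t, ht, hr⟩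
    · exact ⟨⟨⟨⟨A, hA⟩, ⟨_, or_mem_sentencesOver hB hχ⟩⟩, h'⟩,
        ⟨hE.refl hA, hE.or_left hB hχ⟩, Or.inr ⟨hE.or_right hB hχ, fun θ h => (hall ⟨θ, h⟩).elim⟩⟩
  · by_cases hex : ∃ θ, χ = .ex θ
    · obtain ⟨θ, rfl⟩ := hex
      obtain ⟨t, ht, hn⟩ : ∃ t ∈ closedTermsOver S, ¬ E (.and A (subst0 θ t)) B := by
        by_contra! hc
        exact h (hE.ex_and hA hB hχ hc)
      have hθ : subst0 θ t ∈ sentencesOver S := subst0_mem_sentencesOver hχ.1 hχ.2 ht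
      have hr := hE.and_right hA hθ
      refine ⟨⟨⟨⟨_, and_mem_sentencesOver hA hθ⟩, ⟨B, hB⟩⟩, hn⟩,
        ⟨hE.and_left hA hθ, hE.refl hB⟩, Or.inl ⟨?_, ?_⟩⟩
      · exact hE.trans hr (hE.of_prf hθ hχ (.exIntro ht.1 hχ.1 (.self hθ.1)))
      · intro θ' h'
        obtain rfl : θ = θ' := Formula.ex.inj h'
        exact ⟨t, ht, hr⟩
    · exact ⟨⟨⟨⟨_, and_mem_sentencesOver hA hχ⟩, ⟨B, hB⟩⟩, h⟩,
        ⟨hE.and_left hA hχ, hE.refl hB⟩, Or.inl ⟨hE.and_right hA hχ, fun θ h => (hex ⟨θ, h⟩).elim⟩⟩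

/-- Lindenbaum's lemma, in the form of a Rasiowa–Sikorski argument. -/
theorem exists_isSaturated (hS : S.Countable) {A B : Formula L.plus}
    (hA : A ∈ sentencesOver S) (hB : B ∈ sentencesOver S) (hAB : ¬ E A B) :
    ∃ u, IsSaturated S u ∧ A ∈ u ∧ B ∉ u ∧
      ∀ χ θ, χ ∈ u → θ ∈ sentencesOver S → E χ θ → θ ∈ u := by
  let := hE.preorder
  have hc : (sentencesOver S).Countable := (countable_symIn_formula hS).mono fun φ h => h.2
  let := hc.toEncodable
  let D : sentencesOver S → Order.Cofinal (UnrelatedPair S E) := fun χ =>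
    { carrier := {q | (E q.1.1 χ ∧
          ∀ θ, χ.1 = .ex θ → ∃ t ∈ closedTermsOver S, E q.1.1 (subst0 θ t)) ∨
        (E χ q.1.2 ∧ ∀ θ, χ.1 = .all θ → ∃ t ∈ closedTermsOver S, E (subst0 θ t) q.1.2)}
      isCofinal := fun p => by
        obtain ⟨q, hpq, hq⟩ := hE.exists_decided p χ
        exact ⟨q, hq, hpq⟩ }
  let p₀ : UnrelatedPair S E := ⟨⟨⟨A, hA⟩, ⟨B, hB⟩⟩, hAB⟩
  let I := Order.idealOfCofinals p₀ D
  have hp₀ : p₀ ∈ I := Order.mem_idealOfCofinals p₀ D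
  have dir : ∀ p ∈ I, ∀ q ∈ I, ∃ r ∈ I, p ≤ r ∧ q ≤ r := fun p hp q hq =>
    I.directed p hp q hq
  have meets : ∀ χ (hχ : χ ∈ sentencesOver S), ∃ q ∈ I, q ∈ D ⟨χ, hχ⟩ := fun χ hχ =>
    (Order.cofinal_meets_idealOfCofinals p₀ D ⟨χ, hχ⟩).imp fun q h => ⟨h.2, h.1⟩
  let u : Set (Formula L.plus) := {χ | χ ∈ sentencesOver S ∧ ∃ p ∈ I, E p.1.1 χ}
  have not_right : ∀ χ ∈ u, ∀ p ∈ I, ¬ E χ p.1.2 := by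
    rintro χ ⟨hχ, q, hq, hqχ⟩ p hp hχp
    obtain ⟨r, hr, hpr, hqr⟩ := dir p hp q hq
    exact r.2 (hE.trans hqr.1 (hE.trans hqχ (hE.trans hχp hpr.2)))
  have right : ∀ χ ∈ sentencesOver S, χ ∉ u → ∃ p ∈ I, E χ p.1.2 := by
    intro χ hχ hu
    obtain ⟨p, hp, h | h⟩ := meets χ hχ
    exacts [(hu ⟨hχ, p, hp, h.1⟩).elim, ⟨p, hp, h.1⟩]
  have up : ∀ χ θ, χ ∈ u → θ ∈ sentencesOver S → E χ θ → θ ∈ u :=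
    fun χ θ ⟨_, p, hp, h⟩ hθ h' => ⟨hθ, p, hp, hE.trans h h'⟩
  have hAu : A ∈ u := ⟨hA, p₀, hp₀, hE.refl hA⟩
  refine ⟨u, ⟨fun χ h => h.1, ?_, ?_, ?_, ?_, ?_, ?_⟩, hAu, ?_, up⟩
  · exact up A _ hAu top_mem_sentencesOver (hE.of_prf hA top_mem_sentencesOver .topIntro)
  · intro h
    exact not_right _ h p₀ hp₀ (hE.of_prf bot_mem_sentencesOver hB (.botElim hB.1 (.self trivial)))
  · rintro φ ψ ⟨hφ, p, hp, hpφ⟩ ⟨hψ, q, hq, hqψ⟩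
    obtain ⟨r, hr, hpr, hqr⟩ := dir p hp q hq
    exact ⟨and_mem_sentencesOver hφ hψ, r, hr, hE.and (hE.trans hpr.1 hpφ) (hE.trans hqr.1 hqψ)⟩
  · intro φ ψ h
    by_contra! hc
    obtain ⟨p, hp, hpφ⟩ := right φ ⟨h.1.1.1, h.1.2.1⟩ hc.1
    obtain ⟨q, hq, hqψ⟩ := right ψ ⟨h.1.1.2, h.1.2.2⟩ hc.2
    obtain ⟨r, hr, hpr, hqr⟩ := dir p hp q hq
    exact not_right _ h r hr (hE.or (hE.trans hpφ hpr.2) (hE.trans hqψ hqr.2))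
  · intro φ h
    obtain ⟨p, hp, h' | h'⟩ := meets _ h.1
    · obtain ⟨t, ht, hpt⟩ := h'.2 φ rfl
      exact ⟨t, ht, subst0_mem_sentencesOver h.1.1 h.1.2 ht, p, hp, hpt⟩
    · exact (not_right _ h p hp h'.1).elim
  · intro φ hφ h
    obtain ⟨p, hp, h' | h'⟩ := meets _ hφ
    · exact ⟨hφ, p, hp, h'.1⟩
    · obtain ⟨t, ht, hpt⟩ := h'.2 φ rfl
      exact (not_right _ (h t ht) p hp hpt).elim
  · exact fun h => not_right B h p₀ hp₀ (hE.refl hB)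

end IsConsequence

end Lindenbaum

section CanonicalModel

variable {S : Set (L.plus.Const ⊕ L.plus.Func ⊕ L.plus.Rel)} {w u : Set (Formula L.plus)}

/-- A saturated set that is closed under proofs using the members of `w` unsafely. -/
structure IsWorld (S : Set (L.plus.Const ⊕ L.plus.Func ⊕ L.plus.Rel))
    (w u : Set (Formula L.plus)) : Prop extends IsSaturated S u where
  closed : ∀ ψ ∈ sentencesOver S, Prf L w u ψ → ψ ∈ u

theorem IsWorld.isConsequence (hu : IsWorld S w u) :
    IsConsequence S fun A B => Formula.imp A B ∈ u := by
  have hyp : ∀ {χ}, χ ∈ u → Prf L w u χ := fun h => .hyp (Or.inr h) (hu.subset h).1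
  have left : ∀ {A B}, Formula.imp A B ∈ u → A ∈ sentencesOver S := fun h =>
    ⟨(hu.subset h).1.1, (hu.subset h).2.1⟩
  have right : ∀ {A B}, Formula.imp A B ∈ u → B ∈ sentencesOver S := fun h =>
    ⟨(hu.subset h).1.2, (hu.subset h).2.2⟩
  refine ⟨?_, ?_, ?_, ?_, ?_, ?_⟩
  · exact fun hA hB h => hu.closed _ (imp_mem_sentencesOver hA hB) (.imp_of_empty hA.1 h)
  · exact fun h₁ h₂ => hu.closed _ (imp_mem_sentencesOver (left h₁) (right h₂))
      (.intTrans (hyp h₁) (hyp h₂))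
  · exact fun h₁ h₂ => hu.closed _
      (imp_mem_sentencesOver (left h₁) (and_mem_sentencesOver (right h₁) (right h₂)))
      (.intAndIntro (hyp h₁) (hyp h₂))
  · exact fun h₁ h₂ => hu.closed _
      (imp_mem_sentencesOver (or_mem_sentencesOver (left h₁) (left h₂)) (right h₁))
      (.intOrElim (hyp h₁) (hyp h₂))
  · intro A B hA hB h
    refine hu.closed _ (imp_mem_sentencesOver hA hB) (.intExElim hB.1 (hyp (hu.all _
      ⟨⟨hA.1, hB.1.mono (Nat.zero_le _)⟩, hA.2, hB.2⟩ fun t ht => ?_)))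
    change Formula.imp (subst0 A t) (subst0 B t) ∈ u
    rw [hB.1.subst0_eq]
    exact h t ht
  · intro A B hB hA h
    refine hu.closed _ (imp_mem_sentencesOver hA hB) (.intAllIntro hA.1 (hyp (hu.all _
      ⟨⟨hA.1.mono (Nat.zero_le _), hB.1⟩, hA.2, hB.2⟩ fun t ht => ?_)))
    change Formula.imp (subst0 A t) (subst0 B t) ∈ u
    rw [hA.1.subst0_eq]
    exact h t ht

/-- Accessibility between worlds of the canonical model. -/
def Acc (u v : Set (Formula L.plus)) : Prop :=
  ∀ φ ψ, Formula.imp φ ψ ∈ u → φ ∈ v → ψ ∈ v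

theorem IsWorld.subset_of_acc (hu : IsWorld S w u) {v : Set (Formula L.plus)}
    (hv : IsWorld S w v) (h : Acc u v) : u ⊆ v := fun φ hφ =>
  have hs := hu.subset hφ
  h .top φ (hu.closed _ (imp_mem_sentencesOver top_mem_sentencesOver hs)
    (Prf.box (.hyp (Or.inr hφ) hs.1))) hv.top

theorem IsWorld.root_subset (hw : IsWorld S w w) (hu : IsWorld S w u) : w ⊆ u := fun φ hφ =>
  hu.closed φ (hw.subset hφ) (.hyp (Or.inl hφ) (hw.subset hφ).1)

theorem IsWorld.acc_self (hw : IsWorld S w w) : Acc w w := by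
  intro φ ψ h hφ
  have hs := hw.subset h
  exact hw.closed ψ ⟨hs.1.2, hs.2.2⟩
    (.impElim (.hyp (Or.inl hφ) hs.1.1) (.hyp (Or.inl h) hs.1))

theorem IsWorld.exists_acc (hS : S.Countable) (hw : IsWorld S w w) (hu : IsWorld S w u)
    {φ ψ : Formula L.plus} (hs : .imp φ ψ ∈ sentencesOver S) (h : .imp φ ψ ∉ u) :
    ∃ v, IsWorld S w v ∧ Acc u v ∧ φ ∈ v ∧ ψ ∉ v := by
  obtain ⟨v, hv, hφ, hψ, up⟩ := hu.isConsequence.exists_isSaturated hS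
    ⟨hs.1.1, hs.2.1⟩ ⟨hs.1.2, hs.2.2⟩ h
  refine ⟨v, ⟨hv, fun χ hχ p => ?_⟩, fun A B hAB hA => ?_, hφ, hψ⟩
  · obtain ⟨A, hA, q⟩ := p.exists_isConj
    have hAv : A ∈ v := hA.mem_of_subset subset_rfl hv.top hv.and
    have hAχ := imp_mem_sentencesOver (hv.subset hAv) hχ
    exact up A χ hAv hχ (hw.root_subset hu (hw.closed _ hAχ
      (q.weaken subset_rfl (Set.empty_subset _))))
  · have hs := hu.subset hAB
    exact up A B hA ⟨hs.1.2, hs.2.2⟩ hAB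

theorem Prf.of_boxN_singleton {Γ : Set (Formula L.plus)} {A B : Formula L.plus} {n : ℕ}
    (hA : A.Sentence) (h : Prf L Γ {A} (boxN n B)) : Prf L (insert A Γ) ∅ B :=
  of_boxN ((hyp (Or.inl (Set.mem_insert A Γ)) hA).cut
    (h.weaken (Set.subset_insert _ _) subset_rfl))

theorem isConsequence_prf_insert {Γ : Set (Formula L.plus)} (hΓ : ∀ i, FreshIn i Γ)
    (hS : ∀ i, aconst L i ∈ closedTermsOver S) :
    IsConsequence S fun A B => A.Sentence ∧ Prf L (insert A Γ) ∅ B := by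
  refine ⟨?_, ?_, ?_, ?_, ?_, ?_⟩
  · exact fun hA _ h => ⟨hA.1, (Prf.hyp (Or.inl (Set.mem_insert _ Γ)) hA.1).trans h⟩
  · rintro A B C ⟨hA, p⟩ ⟨_, q⟩
    obtain ⟨n, q⟩ := q.exists_boxN_of_insert
    exact ⟨hA, .of_boxN (p.cut (q.weaken (Set.subset_insert _ _) subset_rfl))⟩
  · exact fun h₁ h₂ => ⟨h₁.1, .andIntro h₁.2 h₂.2⟩
  · rintro A B C ⟨hA, p⟩ ⟨hB, q⟩
    obtain ⟨n, p⟩ := p.exists_boxN_of_insert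
    obtain ⟨m, q⟩ := q.exists_boxN_of_insert
    exact ⟨⟨hA, hB⟩, .of_boxN_singleton ⟨hA, hB⟩ (.or_elim_of_singleton (.self ⟨hA, hB⟩)
      (p.boxN_le (le_max_left n m)) (q.boxN_le (le_max_right n m)))⟩
  · intro A B hA _ h
    obtain ⟨i, hiA, hiB⟩ := (A.eventually_not_occC.and B.eventually_not_occC).exists
    obtain ⟨n, p⟩ := (h _ (hS i)).2.exists_boxN_of_insert
    exact ⟨hA.1, .of_boxN_singleton hA.1 (.ex_elim (.self hA.1) (hΓ i) hiA
      (fun h => hiB (occC_of_occC_boxN h)) p)⟩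
  · intro A B _ hA h
    obtain ⟨i, hiA, hiB⟩ := (A.eventually_not_occC.and B.eventually_not_occC).exists
    refine ⟨hA.1, .allIntro subset_rfl subset_rfl ?_ (.empty i) hiB (h _ (hS i)).2⟩
    rintro ψ (rfl | hψ)
    exacts [hiA, hΓ i ψ hψ]

theorem exists_root (hS : S.Countable) (hconst : ∀ i, aconst L i ∈ closedTermsOver S)
    {Γ : Set (Formula L.plus)} (hΓ : ∀ i, FreshIn i Γ) (hΓS : Γ ⊆ sentencesOver S)
    {φ : Formula L.plus} (hφ : φ ∈ sentencesOver S) (h : ¬ Prf L Γ ∅ φ) :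
    ∃ w, IsWorld S w w ∧ Γ ⊆ w ∧ φ ∉ w := by
  have hE := isConsequence_prf_insert hΓ hconst
  have h' : ¬ ((Formula.top : Formula L.plus).Sentence ∧ Prf L (insert .top Γ) ∅ φ) := by
    rintro ⟨_, p⟩
    obtain ⟨n, p⟩ := p.exists_boxN_of_insert
    exact h (.of_boxN (Prf.topIntro.cut p))
  obtain ⟨w, hw, _, hφw, up⟩ := hE.exists_isSaturated hS top_mem_sentencesOver hφ h'
  refine ⟨w, ⟨hw, fun ψ hψ p => ?_⟩, fun γ hγ => ?_, hφw⟩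
  · obtain ⟨A, hA, p⟩ := p.exists_isConj
    obtain ⟨C, n, hC, q⟩ := p.exists_isConj_boxN
    have hAw : A ∈ w := hA.mem_of_subset subset_rfl hw.top hw.and
    have hCw : C ∈ w := hC.mem_of_subset subset_rfl hw.top hw.and
    have hs := imp_mem_sentencesOver (hw.subset hAw) hψ
    have himp : .imp A ψ ∈ w := by
      refine up C _ hCw hs ⟨hC.sentence, .of_boxN (n := n) (.impElim (φ := C) ?_ ?_)⟩
      · exact .hyp (Or.inl (Set.mem_insert _ _)) hC.sentence
      · exact q.weaken (Set.empty_subset _) subset_rfl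
    have hs' := and_mem_sentencesOver (hw.subset hAw) hs
    have r := Prf.hyp (Δ := ∅) (Or.inl (Set.mem_insert _ Γ)) hs'.1
    exact up _ ψ (hw.and _ _ hAw himp) hψ ⟨hs'.1, .impElim (.andElimL r) (.andElimR r)⟩
  · exact up .top γ hw.top (hΓS hγ)
      ⟨trivial, .hyp (Or.inl (Set.mem_insert_of_mem _ hγ)) (hΓS hγ).1⟩

open Classical in
/-- The canonical model of worlds over `w`, with the closed terms over `S` as its domain. -/
noncomputable def canonicalModel (S : Set (L.plus.Const ⊕ L.plus.Func ⊕ L.plus.Rel))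
    (w : Set (Formula L.plus)) (d₀ : closedTermsOver S) : KModel.{0} L.plus where
  W := {u // IsWorld S w u}
  acc u v := Acc u.1 v.1
  D := closedTermsOver S
  interpC c := if h : Sum.inl c ∈ S then ⟨.const c, trivial, h⟩ else d₀
  interpF f ts := if h : Sum.inr (Sum.inl f) ∈ S then
    ⟨.func f fun i => (ts i).1, fun i => (ts i).2.1, h, fun i => (ts i).2.2⟩ else d₀
  interpR R u := {ts | .rel R (fun i => (ts i).1) ∈ u.1}

variable {d₀ : closedTermsOver S}

theorem canonicalModel_proper (hw : IsWorld S w w) : (canonicalModel S w d₀).Proper :=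
  ⟨⟨⟨w, hw⟩⟩, ⟨d₀⟩, fun u v _ huv hvx φ ψ h hφ =>
      hvx φ ψ (u.2.subset_of_acc v.2 huv h) hφ,
    fun _ u v huv _ h => u.2.subset_of_acc v.2 huv h⟩

theorem canonicalModel_eval (ρ : ℕ → closedTermsOver S) {t : Term L.plus} (ht : t.SymIn S) :
    (t.eval (canonicalModel S w d₀) ρ : closedTermsOver S).1 =
      t.applySub fun n => (ρ n).1 := by
  induction t with
  | var n => rfl
  | const c =>
    have h : Sum.inl c ∈ S := ht
    simp only [Term.eval, canonicalModel, h, dite_true, Term.applySub]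
  | func f ts ih =>
    have h : Sum.inr (Sum.inl f) ∈ S := ht.1
    have ih' := fun i => ih i (ht.2 i)
    simp only [Term.eval, Term.applySub, ← ih']
    simp only [canonicalModel, h, dite_true]

theorem coe_vcons {α : Type*} {p : α → Prop} (d : Subtype p) (ρ : ℕ → Subtype p) :
    (fun n => (vcons d ρ n).1) = vcons d.1 fun n => (ρ n).1 := by
  funext n; cases n <;> rfl

theorem canonicalModel_sat (hS : S.Countable) (hw : IsWorld S w w) {φ : Formula L.plus}
    (hφ : φ.SymIn S) (u : {u // IsWorld S w u}) (ρ : ℕ → closedTermsOver S) :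
    Sat (canonicalModel S w d₀) u ρ φ ↔ φ.applySub (fun n => (ρ n).1) ∈ u.1 := by
  have mem : ∀ {φ : Formula L.plus} (ρ : ℕ → closedTermsOver S), φ.SymIn S →
      φ.applySub (fun n => (ρ n).1) ∈ sentencesOver S := fun {φ} ρ hφ =>
    ⟨φ.applySub_closedAt fun n => (ρ n).2.1, hφ.applySub fun n => (ρ n).2.2⟩
  induction φ generalizing u ρ with
  | top => exact ⟨fun _ => u.2.top, fun _ => trivial⟩
  | bot => exact ⟨fun h => h.elim, fun h => u.2.bot h⟩
  | rel R ts =>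
    have h : (fun i => ((ts i).eval (canonicalModel S w d₀) ρ : closedTermsOver S).1) =
        fun i => (ts i).applySub fun n => (ρ n).1 :=
      funext fun i => canonicalModel_eval ρ (hφ.2 i)
    change Formula.rel R _ ∈ u.1 ↔ Formula.rel R _ ∈ u.1
    rw [← h]
  | and φ ψ ih₁ ih₂ =>
    refine (and_congr (ih₁ hφ.1 u ρ) (ih₂ hφ.2 u ρ)).trans
      ⟨fun h => u.2.and _ _ h.1 h.2, fun h => ?_⟩
    have hs := (mem ρ hφ).1
    have p : Prf L w u.1 _ := .hyp (Or.inr h) hs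
    exact ⟨u.2.closed _ (mem ρ hφ.1) (.andElimL p), u.2.closed _ (mem ρ hφ.2) (.andElimR p)⟩
  | or φ ψ ih₁ ih₂ =>
    refine (or_congr (ih₁ hφ.1 u ρ) (ih₂ hφ.2 u ρ)).trans ⟨fun h => ?_, fun h => u.2.or _ _ h⟩
    have h₁ := mem ρ hφ.1
    have h₂ := mem ρ hφ.2
    rcases h with h | h
    · exact u.2.closed _ (mem ρ hφ) (.orIntroL h₂.1 (.hyp (Or.inr h) h₁.1))
    · exact u.2.closed _ (mem ρ hφ) (.orIntroR h₁.1 (.hyp (Or.inr h) h₂.1))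
  | imp φ ψ ih₁ ih₂ =>
    constructor
    · intro h
      by_contra hn
      obtain ⟨v, hv, huv, hφv, hψv⟩ := IsWorld.exists_acc hS hw u.2 (mem ρ hφ) hn
      exact hψv ((ih₂ hφ.2 ⟨v, hv⟩ ρ).1 (h ⟨v, hv⟩ huv ((ih₁ hφ.1 ⟨v, hv⟩ ρ).2 hφv)))
    · intro h v huv hφv
      exact (ih₂ hφ.2 v ρ).2 (huv _ _ h ((ih₁ hφ.1 v ρ).1 hφv))
  | all φ ih =>
    have inst : ∀ d : closedTermsOver S, Sat (canonicalModel S w d₀) u (vcons d ρ) φ ↔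
        subst0 (φ.applySub (liftSub fun n => (ρ n).1)) d.1 ∈ u.1 := by
      intro d
      rw [subst0_liftSub, ← coe_vcons]
      exact ih hφ u (vcons d ρ)
    constructor
    · exact fun h => u.2.all _ (mem ρ hφ) fun t ht => (inst ⟨t, ht⟩).1 (h ⟨t, ht⟩)
    · intro h d
      have hs := mem ρ hφ
      exact (inst d).2 (u.2.closed _ (subst0_mem_sentencesOver hs.1 hs.2 d.2)
        (.allElim d.2.1 (.hyp (Or.inr h) hs.1)))
  | ex φ ih =>
    have inst : ∀ d : closedTermsOver S, Sat (canonicalModel S w d₀) u (vcons d ρ) φ ↔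
        subst0 (φ.applySub (liftSub fun n => (ρ n).1)) d.1 ∈ u.1 := by
      intro d
      rw [subst0_liftSub, ← coe_vcons]
      exact ih hφ u (vcons d ρ)
    constructor
    · rintro ⟨d, hd⟩
      have hs := mem ρ hφ
      have hd' := (inst d).1 hd
      exact u.2.closed _ hs (.exIntro d.2.1 hs.1 (.hyp (Or.inr hd') (u.2.subset hd').1))
    · intro h
      obtain ⟨t, ht, h'⟩ := u.2.ex _ h
      exact ⟨⟨t, ht⟩, (inst ⟨t, ht⟩).2 h'⟩

end CanonicalModel

/-- The `L`-reduct of an `L⁺`-model, in an arbitrary universe. -/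
def KModel.reduct (M : KModel.{0} L.plus) : KModel.{u} L where
  W := ULift M.W
  acc w v := M.acc w.down v.down
  D := ULift M.D
  interpC c := ⟨M.interpC (Sum.inl c)⟩
  interpF f ds := ⟨M.interpF f fun i => (ds i).down⟩
  interpR R w := {ds | (fun i => (ds i).down) ∈ M.interpR R w.down}

theorem KModel.Proper.reduct {M : KModel.{0} L.plus} (h : M.Proper) :
    (KModel.reduct.{u} M).Proper :=
  ⟨h.1.map ULift.up, h.2.1.map ULift.up, fun _ _ _ h₁ h₂ => h.2.2.1 h₁ h₂,
    fun R _ _ huv _ hd => h.2.2.2 R _ _ huv hd⟩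

theorem eval_reduct (M : KModel.{0} L.plus) (ρ : ℕ → ULift.{u} M.D) (t : Term L) :
    (t.eval (KModel.reduct.{u} M) ρ : ULift.{u} M.D).down =
      t.emb.eval M fun n => (ρ n).down := by
  induction t with
  | var n => rfl
  | const c => rfl
  | func f ts ih =>
    change M.interpF f _ = M.interpF f _
    congr 1
    funext i
    exact ih i

theorem sat_reduct (M : KModel.{0} L.plus) (w : M.W) (ρ : ℕ → ULift.{u} M.D) (φ : Formula L) :
    Sat (KModel.reduct.{u} M) ⟨w⟩ ρ φ ↔ Sat M w (fun n => (ρ n).down) φ.emb := by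
  have down_vcons : ∀ (d : ULift.{u} M.D) (ρ : ℕ → ULift.{u} M.D),
      (fun n => (vcons d ρ n).down) = vcons d.down fun n => (ρ n).down := by
    intro d ρ
    funext n; cases n <;> rfl
  induction φ generalizing w ρ with
  | top => exact Iff.rfl
  | bot => exact Iff.rfl
  | rel R ts =>
    have h : (fun i => ((ts i).eval (KModel.reduct.{u} M) ρ : ULift.{u} M.D).down) =
        fun i => (ts i).emb.eval M fun n => (ρ n).down :=
      funext fun i => eval_reduct M ρ (ts i)
    exact Iff.of_eq (congrArg (· ∈ M.interpR R w) h)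
  | and φ ψ ih₁ ih₂ => exact and_congr (ih₁ w ρ) (ih₂ w ρ)
  | or φ ψ ih₁ ih₂ => exact or_congr (ih₁ w ρ) (ih₂ w ρ)
  | imp φ ψ ih₁ ih₂ =>
    exact ⟨fun h v hv hφ => (ih₂ v ρ).1 (h ⟨v⟩ hv ((ih₁ v ρ).2 hφ)),
      fun h v hv hφ => (ih₂ v.down ρ).2 (h v.down hv ((ih₁ v.down ρ).1 hφ))⟩
  | all φ ih =>
    have inst : ∀ d : ULift.{u} M.D, Sat (KModel.reduct.{u} M) ⟨w⟩ (vcons d ρ) φ ↔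
        Sat M w (vcons d.down fun n => (ρ n).down) φ.emb := fun d => by
      rw [← down_vcons]; exact ih w _
    exact ⟨fun h d => (inst ⟨d⟩).1 (h ⟨d⟩), fun h d => (inst d).2 (h d.down)⟩
  | ex φ ih =>
    have inst : ∀ d : ULift.{u} M.D, Sat (KModel.reduct.{u} M) ⟨w⟩ (vcons d ρ) φ ↔
        Sat M w (vcons d.down fun n => (ρ n).down) φ.emb := fun d => by
      rw [← down_vcons]; exact ih w _
    exact ⟨fun ⟨d, h⟩ => ⟨d.down, (inst d).1 h⟩, fun ⟨d, h⟩ => ⟨⟨d⟩, (inst ⟨d⟩).2 h⟩⟩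

/-- `M` refutes `Γ ⊨ φ` at the reflexive world `w`. -/
def IsCountermodel (M : KModel.{u} L) (w : M.W) (Γ : Set (Formula L)) (φ : Formula L) : Prop :=
  M.Proper ∧ M.acc w w ∧ (∀ ψ ∈ Γ, SatS M w ψ) ∧ ¬ SatS M w φ

theorem exists_isCountermodel_of_countable {Γ : Set (Formula L)} (hΓc : Γ.Countable)
    {φ : Formula L} (hΓ : ∀ ψ ∈ Γ, ψ.Sentence) (hφ : φ.Sentence)
    (h : ¬ Prf L (Formula.emb '' Γ) ∅ φ.emb) :
    ∃ (M : KModel.{u} L) (w : M.W), IsCountermodel M w Γ φ := by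
  choose sym hsym hmem using Formula.exists_countable_symIn (L := L.plus)
  let S : Set (L.plus.Const ⊕ L.plus.Func ⊕ L.plus.Rel) :=
    (Set.range fun i : ℕ => Sum.inl (Sum.inr i)) ∪ ⋃ ψ ∈ insert φ Γ, sym ψ.emb
  have hS : S.Countable := (Set.countable_range _).union
    ((hΓc.insert φ).biUnion fun ψ _ => hsym ψ.emb)
  have hconst : ∀ i, aconst L i ∈ closedTermsOver S := fun i =>
    ⟨aconst_closed i, Or.inl ⟨i, rfl⟩⟩
  have hin : ∀ ψ ∈ insert φ Γ, ψ.emb.SymIn S := fun ψ hψ => (hmem ψ.emb).mono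
    ((Set.subset_biUnion_of_mem (u := fun ψ : Formula L => sym ψ.emb) hψ).trans
      Set.subset_union_right)
  obtain ⟨w, hw, hΓw, hφw⟩ := exists_root hS hconst (Γ := Formula.emb '' Γ) (φ := φ.emb)
    (by rintro i _ ⟨ψ, _, rfl⟩; exact ψ.not_occC_emb i)
    (by rintro _ ⟨ψ, hψ, rfl⟩; exact ⟨(hΓ ψ hψ).emb, hin ψ (Or.inr hψ)⟩)
    ⟨hφ.emb, hin φ (Or.inl rfl)⟩ h
  let d₀ : closedTermsOver S := ⟨_, hconst 0⟩
  have sat : ∀ ψ ∈ insert φ Γ, ψ.Sentence → ∀ ρ,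
      (Sat (KModel.reduct.{u} (canonicalModel S w d₀)) ⟨⟨w, hw⟩⟩ ρ ψ ↔ ψ.emb ∈ w) := by
    intro ψ hψ hs ρ
    have hs' : ψ.emb.Sentence := hs.emb
    refine (sat_reduct (canonicalModel S w d₀) ⟨w, hw⟩ ρ ψ).trans
      ((canonicalModel_sat hS hw (hin ψ hψ) ⟨w, hw⟩ _).trans ?_)
    rw [hs'.applySub_eq]
  refine ⟨KModel.reduct.{u} (canonicalModel S w d₀), ⟨⟨w, hw⟩⟩,
    (canonicalModel_proper hw).reduct, hw.acc_self, fun ψ hψ ρ => ?_, fun hn => ?_⟩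
  · exact (sat ψ (Or.inr hψ) (hΓ ψ hψ) ρ).2 (hΓw ⟨ψ, hψ, rfl⟩)
  · exact hφw ((sat φ (Or.inl rfl) hφ fun _ => ⟨d₀⟩).1 (hn _))

section Ultraproduct

variable {ι : Type} (U : Ultrafilter ι) (M : ι → KModel.{u} L)

/-- The product of Kripke models, with accessibility and relations taken modulo `U`. -/
def KModel.ultraproduct : KModel.{u} L where
  W := ∀ i, (M i).W
  acc w v := ∀ᶠ i in U, (M i).acc (w i) (v i)
  D := ∀ i, (M i).D
  interpC c i := (M i).interpC c
  interpF f ds i := (M i).interpF f fun j => ds j i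
  interpR R w := {ds | ∀ᶠ i in U, (fun j => ds j i) ∈ (M i).interpR R (w i)}

variable {M}

theorem KModel.ultraproduct_proper (hM : ∀ i, (M i).Proper) :
    (KModel.ultraproduct U M).Proper :=
  ⟨⟨fun i => (hM i).1.some⟩, ⟨fun i => (hM i).2.1.some⟩,
    fun _ _ _ h₁ h₂ => by
      filter_upwards [h₁, h₂] with i h₁ h₂ using (hM i).2.2.1 h₁ h₂,
    fun R _ _ h _ hd => by
      filter_upwards [h, hd] with i h hd using (hM i).2.2.2 R _ _ h hd⟩

theorem eval_ultraproduct (ρ : ℕ → ∀ i, (M i).D) (t : Term L) (i : ι) :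
    (t.eval (KModel.ultraproduct U M) ρ : ∀ i, (M i).D) i = t.eval (M i) fun n => ρ n i := by
  induction t with
  | var n => rfl
  | const c => rfl
  | func f ts ih =>
    change (M i).interpF f _ = (M i).interpF f _
    congr 1
    funext j
    exact ih j

/-- Łoś's theorem for Kripke models. -/
theorem sat_ultraproduct (hM : ∀ i, (M i).Proper) (w : ∀ i, (M i).W) (ρ : ℕ → ∀ i, (M i).D)
    (φ : Formula L) : Sat (KModel.ultraproduct U M) w ρ φ ↔
      ∀ᶠ i in U, Sat (M i) (w i) (fun n => ρ n i) φ := by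
  have vcons_apply : ∀ (d : ∀ i, (M i).D) (ρ : ℕ → ∀ i, (M i).D) (i : ι),
      (fun n => vcons d ρ n i) = vcons (d i) fun n => ρ n i := by
    intro d ρ i
    funext n; cases n <;> rfl
  induction φ generalizing w ρ with
  | top => exact ⟨fun _ => Filter.Eventually.of_forall fun _ => trivial, fun _ => trivial⟩
  | bot => exact ⟨fun h => h.elim, fun h => h.exists.elim fun _ h => h⟩
  | rel R ts =>
    refine Filter.eventually_congr (Filter.Eventually.of_forall fun i => ?_)
    have h : (fun j => ((ts j).eval (KModel.ultraproduct U M) ρ : ∀ i, (M i).D) i) =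
        fun j => (ts j).eval (M i) fun n => ρ n i :=
      funext fun j => eval_ultraproduct U ρ (ts j) i
    rw [h]
    exact Iff.rfl
  | and φ ψ ih₁ ih₂ =>
    exact (and_congr (ih₁ w ρ) (ih₂ w ρ)).trans Filter.eventually_and.symm
  | or φ ψ ih₁ ih₂ =>
    exact (or_congr (ih₁ w ρ) (ih₂ w ρ)).trans Ultrafilter.eventually_or.symm
  | imp φ ψ ih₁ ih₂ =>
    constructor
    · intro h
      by_contra hn
      rw [← Ultrafilter.eventually_not] at hn
      have hv : ∀ i, ∃ v, ¬ Sat (M i) (w i) (fun n => ρ n i) (.imp φ ψ) →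
          (M i).acc (w i) v ∧ Sat (M i) v (fun n => ρ n i) φ ∧
            ¬ Sat (M i) v (fun n => ρ n i) ψ := by
        intro i
        by_cases hi : Sat (M i) (w i) (fun n => ρ n i) (.imp φ ψ)
        · exact ⟨w i, fun h => (h hi).elim⟩
        · by_contra! hc
          exact hi fun v hv hφ => (hc v).2 hv hφ
      choose v hv using hv
      have h₁ := h v (by filter_upwards [hn] with i hi using (hv i hi).1)
        ((ih₁ v ρ).2 (by filter_upwards [hn] with i hi using (hv i hi).2.1))
      obtain ⟨i, hi, hi'⟩ := (hn.and ((ih₂ v ρ).1 h₁)).exists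
      exact (hv i hi).2.2 hi'
    · intro h v hv hφ
      refine (ih₂ v ρ).2 ?_
      filter_upwards [h, hv, (ih₁ v ρ).1 hφ] with i h hv hφ using h _ hv hφ
  | all φ ih =>
    constructor
    · intro h
      have hd : ∀ i, ∃ d, Sat (M i) (w i) (vcons d fun n => ρ n i) φ →
          Sat (M i) (w i) (fun n => ρ n i) (.all φ) := by
        intro i
        by_cases hi : Sat (M i) (w i) (fun n => ρ n i) (.all φ)
        · exact ⟨(hM i).2.1.some, fun _ => hi⟩
        · obtain ⟨d, hd⟩ := not_forall.1 hi
          exact ⟨d, fun h => (hd h).elim⟩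
      choose d hd using hd
      filter_upwards [(ih w (vcons d ρ)).1 (h d)] with i hi
      rw [vcons_apply] at hi
      exact hd i hi
    · intro h (d : ∀ i, (M i).D)
      refine (ih w (vcons d ρ)).2 ?_
      filter_upwards [h] with i hi
      rw [vcons_apply]
      exact hi (d i)
  | ex φ ih =>
    constructor
    · rintro ⟨(d : ∀ i, (M i).D), hd⟩
      filter_upwards [(ih w (vcons d ρ)).1 hd] with i hi
      rw [vcons_apply] at hi
      exact ⟨d i, hi⟩
    · intro h
      have hd : ∀ i, ∃ d, Sat (M i) (w i) (fun n => ρ n i) (.ex φ) →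
          Sat (M i) (w i) (vcons d fun n => ρ n i) φ := by
        intro i
        by_cases hi : Sat (M i) (w i) (fun n => ρ n i) (.ex φ)
        · exact hi.imp fun d h _ => h
        · exact ⟨(hM i).2.1.some, fun h => (hi h).elim⟩
      choose d hd using hd
      refine ⟨d, (ih w (vcons d ρ)).2 ?_⟩
      filter_upwards [h] with i hi
      rw [vcons_apply]
      exact hd i hi

end Ultraproduct

/-- Compactness of the consequence relation over reflexive worlds. -/
theorem exists_isCountermodel_of_finite {Γ : Set (Formula L)} {φ : Formula L}
    (h : ∀ s : Finset Γ, ∃ (M : KModel.{u} L) (w : M.W),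
      IsCountermodel M w (Subtype.val '' (s : Set Γ)) φ) :
    ∃ (M : KModel.{u} L) (w : M.W), IsCountermodel M w Γ φ := by
  choose M w hM using h
  let U : Ultrafilter (Finset Γ) := Ultrafilter.of Filter.atTop
  have hMp : ∀ s, (M s).Proper := fun s => (hM s).1
  refine ⟨KModel.ultraproduct U M, w, KModel.ultraproduct_proper U hMp,
    Filter.Eventually.of_forall fun s => (hM s).2.1, fun ψ hψ ρ => ?_, fun hφ => ?_⟩
  · refine (sat_ultraproduct U hMp w ρ ψ).2 (Filter.Eventually.filter_mono
      (Ultrafilter.of_le _) ?_)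
    filter_upwards [Filter.eventually_ge_atTop {⟨ψ, hψ⟩}] with s hs
    exact (hM s).2.2.1 ψ ⟨⟨ψ, hψ⟩, hs (Finset.mem_singleton_self _), rfl⟩ _
  · choose ρ hρ using fun s => not_forall.1 (hM s).2.2.2
    obtain ⟨s, hs⟩ := ((sat_ultraproduct U hMp w (fun n s => ρ s n) φ).1 (hφ _)).exists
    exact hρ s hs

/-- **Completeness** (Theorem 15): if `Γ ⊨ φ` then `Γ ⊢ φ`. -/
theorem completeness {L : Signature} (Γ : Set (Formula L)) (φ : Formula L)
    (hΓ : ∀ ψ ∈ Γ, ψ.Sentence) (hφ : φ.Sentence)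
    (h : Models.{u} Γ φ) : Prv L (Formula.emb '' Γ) φ.emb := by
  by_contra hn
  obtain ⟨M, w, hM, hw, hsat, hφ'⟩ := exists_isCountermodel_of_finite.{u} (Γ := Γ) (φ := φ)
    fun s => exists_isCountermodel_of_countable (s.finite_toSet.image _).countable
      (by rintro _ ⟨ψ, _, rfl⟩; exact hΓ ψ.1 ψ.2) hφ fun p => hn (p.weaken (Set.image_mono (by
        rintro _ ⟨ψ, _, rfl⟩; exact ψ.2)) subset_rfl)
  exact hφ' (h M hM w hw hsat)

end BQL
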